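/- arXiv:2202.10592 — 5 statements merged into one kernel-verified Lean document; each statement's English description precedes it below -/
import Mathlib

section
/- Let n ≥ 2, let Ω ⊂ ℝ^n be a bounded domain, 0 < T < ∞, and let H satisfy Conditions A, B, C with k₁ = 0 (so H(p,X) = H(X) and k = 1). Let u be lower semicontinuous on Ω_T and a viscosity supersolution of H(D²u) − u_t = 0 in Ω_T, and set m = inf_{Ω_T} u. If (p,τ) ∈ Ω_T satisfies u(p,τ) > m, then u(x,t) > m for every (x,t) ∈ Ω × (τ,T). Consequently, if u(p,τ) = m for some (p,τ) ∈ Ω_T, then u(x,t) = m for all (x,t) ∈ Ω × (0,τ). No smoothness of ∂Ω is assumed (strong minimum principle, case k = 1). -/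
open Set Filter Metric

noncomputable section

namespace DNLP

/-- Euclidean space ℝⁿ. -/
abbrev En (n : ℕ) := EuclideanSpace ℝ (Fin n)

/-- n×n real matrices (we use these for the symmetric matrices Sⁿ). -/
abbrev Sym (n : ℕ) := Matrix (Fin n) (Fin n) ℝ

variable {n : ℕ}

/-- Loewner order: X ≤ Y iff Y − X is positive semidefinite. -/
def LoewnerLE (X Y : Sym n) : Prop := (Y - X).PosSemidef

/-- Rank-one matrix p ⊗ q with entries pᵢ qⱼ. -/
def vouter (p q : En n) : Sym n := Matrix.of fun i j => p i * q j

/-- Spatial gradient of ψ(·,t) at y. -/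
def sgrad (ψ : En n → ℝ → ℝ) (y : En n) (t : ℝ) : En n :=
  gradient (fun x => ψ x t) y

/-- Spatial Hessian matrix of ψ(·,t) at y. -/
def shess (ψ : En n → ℝ → ℝ) (y : En n) (t : ℝ) : Sym n :=
  Matrix.of fun i j =>
    fderiv ℝ (fun x => fderiv ℝ (fun x' => ψ x' t) x (EuclideanSpace.single j (1:ℝ))) y
      (EuclideanSpace.single i (1:ℝ))

/-- Time derivative ψ_t at (y,t). -/
def tpartial (ψ : En n → ℝ → ℝ) (y : En n) (t : ℝ) : ℝ := deriv (fun s => ψ y s) t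

/-- Test functions: C² in x and C¹ in t. -/
def IsTestFn (ψ : En n → ℝ → ℝ) : Prop :=
  (∀ t, ContDiff ℝ 2 fun x => ψ x t) ∧ (∀ x, ContDiff ℝ 1 fun s => ψ x s)

/-- Condition A: continuity, H(p,0)=0 and degenerate ellipticity (monotonicity). -/
def CondA (H : En n → Sym n → ℝ) : Prop :=
  Continuous (fun q : En n × Sym n => H q.1 q.2) ∧
  (∀ p, H p 0 = 0) ∧
  ∀ (p : En n) (X Y : Sym n), LoewnerLE X Y → H p X ≤ H p Y

/-- Condition B: homogeneity of degree k₁ in the gradient and degree 1 in the Hessian. -/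
def CondB (H : En n → Sym n → ℝ) (k₁ : ℝ) : Prop :=
  0 ≤ k₁ ∧
  (∀ (θ : ℝ) (p : En n) (X : Sym n), H (θ • p) X = |θ| ^ k₁ * H p X) ∧
  ∀ (θ : ℝ), 0 < θ → ∀ (p : En n) (X : Sym n), H p (θ • X) = θ * H p X

/-- Condition C (coercivity): m(Λ) > 0 for Λ < 1 and M(Λ) < 0 for Λ ≥ Λ₁, expressed
pointwise over unit vectors (equivalent by compactness of the sphere and continuity). -/
def CondC (H : En n → Sym n → ℝ) : Prop :=
  (∀ Λ : ℝ, Λ < 1 → ∀ e : En n, ‖e‖ = 1 →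
      0 < H e (1 - Λ • vouter e e) ∧ H e (Λ • vouter e e - 1) < 0) ∧
  ∃ Λ₁ : ℝ, 1 ≤ Λ₁ ∧ ∀ Λ : ℝ, Λ₁ ≤ Λ → ∀ e : En n, ‖e‖ = 1 →
      H e (1 - Λ • vouter e e) < 0 ∧ 0 < H e (Λ • vouter e e - 1)

/-- Viscosity supersolution of H(Du,D²u) − u^{k−1} u_t = 0 on the set Q (Γ_k[u] ≤ 0). -/
def ParSuper (H : En n → Sym n → ℝ) (k : ℝ) (Q : Set (En n × ℝ)) (u : En n → ℝ → ℝ) : Prop :=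
  ∀ ψ : En n → ℝ → ℝ, IsTestFn ψ → ∀ y t, (y, t) ∈ Q →
    IsLocalMinOn (fun p : En n × ℝ => u p.1 p.2 - ψ p.1 p.2) Q (y, t) →
    H (sgrad ψ y t) (shess ψ y t) - u y t ^ (k - 1) * tpartial ψ y t ≤ 0

/-- Viscosity subsolution of H(Du,D²u) − u^{k−1} u_t = 0 on the set Q (Γ_k[u] ≥ 0). -/
def ParSub (H : En n → Sym n → ℝ) (k : ℝ) (Q : Set (En n × ℝ)) (u : En n → ℝ → ℝ) : Prop :=
  ∀ ψ : En n → ℝ → ℝ, IsTestFn ψ → ∀ y t, (y, t) ∈ Q →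
    IsLocalMaxOn (fun p : En n × ℝ => u p.1 p.2 - ψ p.1 p.2) Q (y, t) →
    0 ≤ H (sgrad ψ y t) (shess ψ y t) - u y t ^ (k - 1) * tpartial ψ y t

/-- The parabolic cylinder Ω_T = Ω × (0,T). -/
def pcyl (Ω : Set (En n)) (T : ℝ) : Set (En n × ℝ) := Ω ×ˢ Ioo 0 T

/-- The parabolic boundary P_T = (cl(Ω) × {0}) ∪ (∂Ω × [0,T)). -/
def pbdry (Ω : Set (En n)) (T : ℝ) : Set (En n × ℝ) :=
  (closure Ω ×ˢ ({0} : Set ℝ)) ∪ (frontier Ω ×ˢ Ico 0 T)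

/-- Ω_∞ = Ω × (0,∞). -/
def pcylInf (Ω : Set (En n)) : Set (En n × ℝ) := Ω ×ˢ Ioi 0

/-- P_∞ = (cl(Ω) × {0}) ∪ (∂Ω × [0,∞)). -/
def pbdryInf (Ω : Set (En n)) : Set (En n × ℝ) :=
  (closure Ω ×ˢ ({0} : Set ℝ)) ∪ (frontier Ω ×ˢ Ici 0)

/-- Viscosity subsolution of F(t,Du,D²u + Du⊗Du) − f(t) u_t = 0 on Q. -/
def ParSubF (F : ℝ → En n → Sym n → ℝ) (f : ℝ → ℝ) (Q : Set (En n × ℝ))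
    (u : En n → ℝ → ℝ) : Prop :=
  ∀ ψ : En n → ℝ → ℝ, IsTestFn ψ → ∀ y t, (y, t) ∈ Q →
    IsLocalMaxOn (fun p : En n × ℝ => u p.1 p.2 - ψ p.1 p.2) Q (y, t) →
    0 ≤ F t (sgrad ψ y t) (shess ψ y t + vouter (sgrad ψ y t) (sgrad ψ y t))
        - f t * tpartial ψ y t

/-- Viscosity supersolution of F(t,Du,D²u + Du⊗Du) − f(t) u_t = 0 on Q. -/
def ParSuperF (F : ℝ → En n → Sym n → ℝ) (f : ℝ → ℝ) (Q : Set (En n × ℝ))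
    (u : En n → ℝ → ℝ) : Prop :=
  ∀ ψ : En n → ℝ → ℝ, IsTestFn ψ → ∀ y t, (y, t) ∈ Q →
    IsLocalMinOn (fun p : En n × ℝ => u p.1 p.2 - ψ p.1 p.2) Q (y, t) →
    F t (sgrad ψ y t) (shess ψ y t + vouter (sgrad ψ y t) (sgrad ψ y t))
        - f t * tpartial ψ y t ≤ 0

/-- Viscosity subsolution of H(Dw, D²w + Dw⊗Dw) − w_t = 0 on Q. -/
def ParSubLog (H : En n → Sym n → ℝ) (Q : Set (En n × ℝ)) (w : En n → ℝ → ℝ) : Prop :=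
  ParSubF (fun _ p X => H p X) (fun _ => 1) Q w

/-- Viscosity supersolution of H(Dw, D²w + Dw⊗Dw) − w_t = 0 on Q. -/
def ParSuperLog (H : En n → Sym n → ℝ) (Q : Set (En n × ℝ)) (w : En n → ℝ → ℝ) : Prop :=
  ParSuperF (fun _ p X => H p X) (fun _ => 1) Q w

/-- Hessian matrix of φ : ℝⁿ → ℝ at y. -/
def ehess (φ : En n → ℝ) (y : En n) : Sym n :=
  Matrix.of fun i j =>
    fderiv ℝ (fun x => fderiv ℝ φ x (EuclideanSpace.single j (1:ℝ))) y
      (EuclideanSpace.single i (1:ℝ))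

/-- Elliptic viscosity condition H(Du,D²u) ≥ f in Ω (subsolution). -/
def EllSub (H : En n → Sym n → ℝ) (Ω : Set (En n)) (u : En n → ℝ) (f : En n → ℝ) : Prop :=
  ∀ φ : En n → ℝ, ContDiff ℝ 2 φ → ∀ y ∈ Ω,
    IsLocalMaxOn (fun x => u x - φ x) Ω y →
    f y ≤ H (gradient φ y) (ehess φ y)

/-- Elliptic viscosity condition H(Dv,D²v) ≤ f in Ω (supersolution). -/
def EllSuper (H : En n → Sym n → ℝ) (Ω : Set (En n)) (v : En n → ℝ) (f : En n → ℝ) : Prop :=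
  ∀ φ : En n → ℝ, ContDiff ℝ 2 φ → ∀ y ∈ Ω,
    IsLocalMinOn (fun x => v x - φ x) Ω y →
    H (gradient φ y) (ehess φ y) ≤ f y

/-- Uniform outer ball condition. -/
def UnifOuterBall (Ω : Set (En n)) : Prop :=
  ∃ ρ₀ : ℝ, 0 < ρ₀ ∧ ∀ y ∈ frontier Ω, ∃ q : En n,
    q ∉ Ω ∧ Metric.ball q ρ₀ ⊆ Ωᶜ ∧ y ∈ Metric.sphere q ρ₀

/-- Outer ball condition (radius may vary with the boundary point). -/
def OuterBallCond (Ω : Set (En n)) : Prop :=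
  ∀ y ∈ frontier Ω, ∃ ρ : ℝ, 0 < ρ ∧ ∃ q : En n,
    q ∉ Ω ∧ Metric.ball q ρ ⊆ Ωᶜ ∧ y ∈ Metric.sphere q ρ

/-- The first derivative of a shifted Gaussian. -/
lemma hasFDerivAt_gaussian (K α C : ℝ) (c x : En n) :
    HasFDerivAt (fun x : En n => K * (Real.exp (-α * ‖x - c‖ ^ 2) - C))
      ((-(2 * α * K) * Real.exp (-α * ‖x - c‖ ^ 2)) • innerSL ℝ (x - c)) x := by
  have h := (((((hasFDerivAt_id x).sub_const c).norm_sq).const_mul (-α)).exp.sub_const C).const_mul K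
  refine h.congr_fderiv ?_
  ext w
  simp
  ring

/-- The Hessian of a shifted Gaussian. -/
lemma ehess_gaussian (K α C : ℝ) (c y : En n) :
    ehess (fun x : En n => K * (Real.exp (-α * ‖x - c‖ ^ 2) - C)) y =
      (K * (2 * α * Real.exp (-α * ‖y - c‖ ^ 2))) •
        ((2 * α) • vouter (y - c) (y - c) - 1) := by
  ext i j
  have hfst : (fun x : En n => fderiv ℝ
      (fun x : En n => K * (Real.exp (-α * ‖x - c‖ ^ 2) - C)) x (EuclideanSpace.single j (1 : ℝ)))
      = fun x => (-(2 * α * K) * (Real.exp (-α * ‖x - c‖ ^ 2) - 0)) * (x - c) j := by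
    funext x
    rw [(hasFDerivAt_gaussian K α C c x).fderiv]
    simp [EuclideanSpace.inner_single_right]
  have hcoord : HasFDerivAt (fun x : En n => (x - c) j)
      (EuclideanSpace.proj j : En n →L[ℝ] ℝ) y := by
    simpa using ((EuclideanSpace.proj j : En n →L[ℝ] ℝ).hasFDerivAt (x := y)).sub_const (c j)
  simp only [ehess, Matrix.of_apply]
  rw [hfst, ((hasFDerivAt_gaussian (-(2 * α * K)) α 0 c y).fun_mul hcoord).fderiv]
  by_cases hij : i = j
  · subst hij
    simp [vouter, EuclideanSpace.inner_single_right]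
    ring
  · simp [vouter, EuclideanSpace.inner_single_right, hij, Ne.symm hij]
    ring

/-- The time derivative of a Gaussian whose centre moves with constant velocity `v`. -/
lemma hasDerivAt_moving_gaussian (α C τ : ℝ) (p v x : En n) {B : ℝ → ℝ} {B' s : ℝ}
    (hB : HasDerivAt B B' s) :
    HasDerivAt (fun s => B s * (Real.exp (-α * ‖x - (p + (s - τ) • v)‖ ^ 2) - C))
      (B' * (Real.exp (-α * ‖x - (p + (s - τ) • v)‖ ^ 2) - C) +
        B s * (2 * α * Real.exp (-α * ‖x - (p + (s - τ) • v)‖ ^ 2) *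
          inner ℝ (x - (p + (s - τ) • v)) v)) s := by
  have hc : HasDerivAt (fun s : ℝ => x - (p + (s - τ) • v)) (-v) s := by
    simpa using (((hasDerivAt_id s).sub_const τ).smul_const v).const_add p |>.const_sub x
  refine (hB.fun_mul ((hc.norm_sq.const_mul (-α)).exp.sub_const C)).congr_deriv ?_
  simp only [inner_neg_right]
  ring

/-- An operator homogeneous of degree zero in the gradient does not depend on it. -/
lemma CondB.eq_zero_left {H : En n → Sym n → ℝ} (hB : CondB H 0) (p : En n) (X : Sym n) :
    H p X = H 0 X := by
  simpa using (hB.2.1 0 p X).symm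

lemma vouter_smul (a : ℝ) (e : En n) : vouter (a • e) (a • e) = a ^ 2 • vouter e e := by
  ext i j
  simp [vouter]
  ring

lemma posSemidef_vouter (z : En n) : (vouter z z).PosSemidef := by
  simpa [vouter, Matrix.vecMulVec] using!
    Matrix.posSemidef_vecMulVec_self_star (R := ℝ) (fun i => z i)

/-- The operator grows linearly along `2α z ⊗ z - I`, uniformly away from the origin. -/
lemma exists_growth_rate {H : En n → Sym n → ℝ} (hA : CondA H) (hB : CondB H 0)
    (hC : CondC H) {ρ : ℝ} (hρ : 0 < ρ) (N : ℝ) :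
    ∃ α : ℝ, 0 < α ∧ ∀ z : En n, ρ ≤ ‖z‖ → N < H 0 ((2 * α) • vouter z z - 1) := by
  obtain ⟨-, Λ, hΛ, hpos⟩ := hC
  obtain ⟨κ, hκ, hle⟩ : ∃ κ, 0 < κ ∧
      ∀ e ∈ sphere (0 : En n) 1, κ ≤ H 0 (Λ • vouter e e - 1) := by
    refine (isCompact_sphere (0 : En n) 1).exists_forall_le' (a := 0) ?_ ?_
    · refine (hA.1.comp (Continuous.prodMk continuous_const ?_)).continuousOn
      unfold vouter
      refine Continuous.sub (Continuous.const_smul ?_ Λ) continuous_const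
      exact continuous_matrix fun i j => by simp only [Matrix.of_apply]; fun_prop
    · intro e he
      rw [← hB.eq_zero_left e]
      exact (hpos Λ le_rfl e (by simpa using he)).2
  set S : ℝ := max 1 (|N| / κ + 1) with hS
  have hS1 : 1 ≤ S := le_max_left _ _
  have hSN : N < S * κ := by
    have h1 : |N| / κ + 1 ≤ S := le_max_right _ _
    have h2 : (|N| / κ + 1) * κ ≤ S * κ := by gcongr
    have h3 : (|N| / κ + 1) * κ = |N| + κ := by field_simp
    linarith [le_abs_self N]
  refine ⟨S * Λ / (2 * ρ ^ 2), by positivity, fun z hz => ?_⟩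
  have hz0 : 0 < ‖z‖ := hρ.trans_le hz
  set e : En n := ‖z‖⁻¹ • z with he
  have hnorm : ‖e‖ = 1 := by simp [he, norm_smul, hz0.ne']
  have hze : z = ‖z‖ • e := by simp [he, smul_smul, hz0.ne']
  have hcmp : LoewnerLE (S • (Λ • vouter e e - 1))
      ((2 * (S * Λ / (2 * ρ ^ 2))) • vouter z z - 1) := by
    have hdiff : (2 * (S * Λ / (2 * ρ ^ 2))) • vouter z z - 1 - S • (Λ • vouter e e - 1)
        = (S * Λ * (‖z‖ ^ 2 / ρ ^ 2 - 1)) • vouter e e + (S - 1) • (1 : Sym n) := by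
      conv_lhs => rw [hze, vouter_smul]
      have : ρ ≠ 0 := hρ.ne'
      ext i j
      simp
      field_simp
      ring
    unfold LoewnerLE
    rw [hdiff]
    have hq : 1 ≤ ‖z‖ ^ 2 / ρ ^ 2 := by
      rw [one_le_div (by positivity)]
      gcongr
    have hcoef : 0 ≤ S * Λ * (‖z‖ ^ 2 / ρ ^ 2 - 1) :=
      mul_nonneg (by positivity) (by linarith)
    exact ((posSemidef_vouter e).smul hcoef).add (Matrix.PosSemidef.one.smul (by linarith))
  calc N < S * κ := hSN
    _ ≤ S * H 0 (Λ • vouter e e - 1) := by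
      gcongr
      exact hle e (by simpa using hnorm)
    _ = H 0 (S • (Λ • vouter e e - 1)) := (hB.2.2 S (by linarith) 0 _).symm
    _ ≤ _ := hA.2.2 0 _ _ hcmp

/-- Positivity of `u - m` is transported forward in time along a uniformly moving ball. -/
lemma ParSuper.lt_of_moving_ball {H : En n → Sym n → ℝ} (hA : CondA H) (hB : CondB H 0)
    (hC : CondC H) {Q : Set (En n × ℝ)} {u : En n → ℝ → ℝ} {m : ℝ}
    (hlsc : LowerSemicontinuousOn (fun p : En n × ℝ => u p.1 p.2) Q)
    (hsuper : ParSuper H 1 Q u) (hm : ∀ x t, (x, t) ∈ Q → m ≤ u x t)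
    {p v : En n} {τ t₁ r c : ℝ} (hr : 0 < r) (hc : 0 < c)
    (hinit : ∀ x, ‖x - p‖ ≤ r → m + c ≤ u x τ)
    (hsub : ∀ x s, τ ≤ s → s ≤ t₁ → ‖x - (p + (s - τ) • v)‖ ≤ r → (x, s) ∈ Q)
    {t : ℝ} (hτt : τ ≤ t) (htt₁ : t < t₁) : m < u (p + (t - τ) • v) t := by
  obtain ⟨α, hα, hgrow⟩ := exists_growth_rate hA hB hC (half_pos hr) (r * ‖v‖)
  set C : ℝ := Real.exp (-α * r ^ 2) with hCdef
  have hCpos : 0 < C := Real.exp_pos _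
  set g₀ : ℝ := Real.exp (-α * (r / 2) ^ 2) - C with hg₀def
  have hg₀ : 0 < g₀ := by
    rw [hg₀def, hCdef, sub_pos, Real.exp_lt_exp]
    nlinarith [mul_pos hα (pow_pos hr 2)]
  set l : ℝ := 2 * α * (|H 0 (-1)| + r * ‖v‖) / g₀ + 1 with hldef
  have hl : 0 < l := by positivity
  set a : ℝ → ℝ := fun s => c * (Real.exp (-l * (s - τ)) - Real.exp (-l * (t₁ - τ))) with hadef
  have ha_pos : ∀ s, s < t₁ → 0 < a s := fun s hs => by
    refine mul_pos hc (sub_pos.2 (Real.exp_lt_exp.2 ?_))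
    nlinarith
  have ha_end : a t₁ = 0 := by simp [hadef]
  have ha_init : a τ < c := by
    have : 0 < c * Real.exp (-l * (t₁ - τ)) := mul_pos hc (Real.exp_pos _)
    simp only [hadef, sub_self, mul_zero, Real.exp_zero]
    linarith
  have ha_deriv : ∀ s, HasDerivAt a (-l * (c * Real.exp (-l * (s - τ)))) s := fun s => by
    have h := (((((hasDerivAt_id s).sub_const τ).const_mul (-l)).exp).sub_const
      (Real.exp (-l * (t₁ - τ)))).const_mul c
    refine h.congr_deriv ?_
    simp
    ring
  set ψ : En n → ℝ → ℝ := fun x s =>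
    a s * (Real.exp (-α * ‖x - (p + (s - τ) • v)‖ ^ 2) - C) with hψdef
  have hψcont : Continuous (fun q : En n × ℝ => ψ q.1 q.2) := by
    simp only [hψdef, hadef]
    fun_prop
  have htest : IsTestFn ψ := by
    refine ⟨fun s => ?_, fun x => ?_⟩
    · have : ContDiff ℝ 2 fun x : En n => ‖x - (p + (s - τ) • v)‖ ^ 2 :=
        ContDiff.norm_sq ℝ (by fun_prop)
      simp only [hψdef]
      fun_prop
    · have : ContDiff ℝ 1 fun s : ℝ => ‖x - (p + (s - τ) • v)‖ ^ 2 :=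
        ContDiff.norm_sq ℝ (by fun_prop)
      simp only [hψdef, hadef]
      fun_prop
  have hbump_pos : ∀ z : En n, 0 < Real.exp (-α * ‖z‖ ^ 2) - C → ‖z‖ < r := fun z hz => by
    rw [sub_pos, hCdef, Real.exp_lt_exp] at hz
    by_contra! h
    have : r ^ 2 ≤ ‖z‖ ^ 2 := by gcongr
    nlinarith
  set K : Set (En n × ℝ) :=
    {q | τ ≤ q.2 ∧ q.2 ≤ t₁ ∧ ‖q.1 - (p + (q.2 - τ) • v)‖ ≤ r} with hKdef
  have hKQ : K ⊆ Q := fun q hq => hsub q.1 q.2 hq.1 hq.2.1 hq.2.2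
  have hKcomp : IsCompact K := by
    have himg : K = (fun q : En n × ℝ => (q.1 + (p + (q.2 - τ) • v), q.2)) ''
        (closedBall 0 r ×ˢ Icc τ t₁) := by
      ext ⟨x, s⟩
      simp only [hKdef, mem_ofPred_eq, mem_image, mem_prod, mem_closedBall, dist_zero_right,
        mem_Icc, Prod.mk.injEq, Prod.exists]
      constructor
      · rintro ⟨h1, h2, h3⟩
        exact ⟨x - (p + (s - τ) • v), s, ⟨h3, h1, h2⟩, by simp, rfl⟩
      · rintro ⟨z, s, ⟨h3, h1, h2⟩, rfl, rfl⟩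
        exact ⟨h1, h2, by simpa using h3⟩
    rw [himg]
    exact ((isCompact_closedBall _ _).prod isCompact_Icc).image (by fun_prop)
  have hmemK : (p + (t - τ) • v, t) ∈ K := ⟨hτt, htt₁.le, by simpa using hr.le⟩
  have hlscK : LowerSemicontinuousOn (fun q : En n × ℝ => u q.1 q.2 - ψ q.1 q.2) K := by
    have h1 : LowerSemicontinuousOn (fun q : En n × ℝ => -ψ q.1 q.2) K :=
      hψcont.neg.continuousOn.lowerSemicontinuousOn
    simpa only [sub_eq_add_neg] using (hlsc.mono hKQ).add h1
  obtain ⟨⟨y, s⟩, hysK, hmin⟩ := hlscK.exists_isMinOn ⟨_, hmemK⟩ hKcomp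
  have hcompare : m ≤ u y s - ψ y s := by
    by_contra! hneg
    have hψpos : 0 < ψ y s := by linarith [hm y s (hKQ hysK)]
    obtain ⟨hs1, hs2, hs3⟩ := hysK
    simp only at hs1 hs2 hs3
    have hst₁ : s < t₁ := by
      refine lt_of_le_of_ne hs2 fun h => ?_
      simp [hψdef, h, ha_end] at hψpos
    have has : 0 < a s := ha_pos s hst₁
    have hgpos : 0 < Real.exp (-α * ‖y - (p + (s - τ) • v)‖ ^ 2) - C :=
      pos_of_mul_pos_right hψpos has.le
    have hyr : ‖y - (p + (s - τ) • v)‖ < r := hbump_pos _ hgpos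
    have hτs : τ < s := by
      refine lt_of_le_of_ne hs1 fun h => ?_
      subst h
      have hexp : Real.exp (-α * ‖y - (p + (τ - τ) • v)‖ ^ 2) ≤ 1 :=
        Real.exp_le_one_iff.2 (by nlinarith [sq_nonneg ‖y - (p + (τ - τ) • v)‖])
      have h1 : ψ y τ < c :=
        calc ψ y τ ≤ a τ * 1 := by
              simp only [hψdef]
              gcongr
              linarith
          _ < c := by linarith
      have h2 := hinit y (by simpa using hyr.le)
      linarith
    have hKnhds : K ∈ nhds (y, s) := by
      have hopen : IsOpen {q : En n × ℝ | τ < q.2 ∧ q.2 < t₁ ∧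
          ‖q.1 - (p + (q.2 - τ) • v)‖ < r} :=
        (isOpen_lt continuous_const continuous_snd).and
          ((isOpen_lt continuous_snd continuous_const).and
            (isOpen_lt (by fun_prop) continuous_const))
      exact mem_of_superset (hopen.mem_nhds ⟨hτs, hst₁, hyr⟩)
        fun q hq => ⟨hq.1.le, hq.2.1.le, hq.2.2.le⟩
    have hloc : IsLocalMinOn (fun q : En n × ℝ => u q.1 q.2 - ψ q.1 q.2) Q (y, s) :=
      (hmin.isLocalMin hKnhds).on Q
    have hvisc := hsuper ψ htest y s (mem_of_mem_nhds (mem_of_superset hKnhds hKQ)) hloc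
    rw [hB.eq_zero_left, show shess ψ y s = _ from ehess_gaussian (a s) α C (p + (s - τ) • v) y,
      show tpartial ψ y s = _ from
        (hasDerivAt_moving_gaussian α C τ p v y (ha_deriv s)).deriv,
      hB.2.2 _ (by positivity), sub_self, Real.rpow_zero, one_mul] at hvisc
    set z := y - (p + (s - τ) • v) with hz
    set E := Real.exp (-α * ‖z‖ ^ 2) with hE
    have hEpos : 0 < E := Real.exp_pos _
    have hE1 : E ≤ 1 := Real.exp_le_one_iff.2 (by nlinarith [sq_nonneg ‖z‖])
    have hinner : inner ℝ z v ≤ r * ‖v‖ :=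
      (real_inner_le_norm z v).trans (by gcongr)
    have hae : a s ≤ c * Real.exp (-l * (s - τ)) := by
      have : 0 < c * Real.exp (-l * (t₁ - τ)) := mul_pos hc (Real.exp_pos _)
      simp only [hadef]
      linarith
    have hkey : 2 * α * E * (H 0 ((2 * α) • vouter z z - 1) - inner ℝ z v) + l * (E - C) ≤ 0 := by
      refine nonpos_of_mul_nonpos_right (b := _) (a := a s) ?_ has
      have : l * (E - C) * a s ≤ l * (E - C) * (c * Real.exp (-l * (s - τ))) := by gcongr
      linarith
    rcases le_or_gt (r / 2) ‖z‖ with hfar | hnear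
    · have h1 := hgrow z hfar
      have h2 : 0 < 2 * α * E * (H 0 ((2 * α) • vouter z z - 1) - inner ℝ z v) :=
        mul_pos (by positivity) (by linarith)
      have h3 : 0 < l * (E - C) := mul_pos hl hgpos
      linarith
    · have hg : g₀ ≤ E - C := by
        have : ‖z‖ ^ 2 ≤ (r / 2) ^ 2 := by gcongr
        have : E ≥ Real.exp (-α * (r / 2) ^ 2) := Real.exp_le_exp.2 (by nlinarith)
        linarith
      have hHlow : -|H 0 (-1)| ≤ H 0 ((2 * α) • vouter z z - 1) := by
        refine (neg_abs_le _).trans (hA.2.2 0 _ _ ?_)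
        have hdiff : (2 * α) • vouter z z - 1 - (-1 : Sym n) = (2 * α) • vouter z z := by abel
        unfold LoewnerLE
        rw [hdiff]
        exact (posSemidef_vouter z).smul (by positivity)
      set D : ℝ := |H 0 (-1)| + r * ‖v‖ with hD
      have hD0 : 0 ≤ D := by positivity
      have h1 : 2 * α * E * (-D) ≤
          2 * α * E * (H 0 ((2 * α) • vouter z z - 1) - inner ℝ z v) := by
        gcongr
        linarith
      have h2 : 2 * α * E * D ≤ 2 * α * 1 * D := by gcongr
      have h3 : l * g₀ ≤ l * (E - C) := by gcongr
      have h4 : l * g₀ = 2 * α * D + g₀ := by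
        rw [hldef]
        field_simp
      linarith
  have hval : 0 < ψ (p + (t - τ) • v) t := by
    refine mul_pos (ha_pos t htt₁) ?_
    rw [sub_self, norm_zero, hCdef, sub_pos, Real.exp_lt_exp]
    nlinarith [mul_pos hα (pow_pos hr 2)]
  have hle : u y s - ψ y s ≤ u (p + (t - τ) • v) t - ψ (p + (t - τ) • v) t := hmin hmemK
  linarith

/-- Positivity of `u - m` spreads to nearby points at every later time. -/
lemma ParSuper.lt_of_dist_le {H : En n → Sym n → ℝ} (hA : CondA H) (hB : CondB H 0)
    (hC : CondC H) {Ω : Set (En n)} (hΩ : IsOpen Ω) {T : ℝ} {u : En n → ℝ → ℝ} {m : ℝ}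
    (hlsc : LowerSemicontinuousOn (fun p : En n × ℝ => u p.1 p.2) (pcyl Ω T))
    (hsuper : ParSuper H 1 (pcyl Ω T) u) (hm : ∀ x t, (x, t) ∈ pcyl Ω T → m ≤ u x t)
    {p q : En n} {τ t ρ : ℝ} (hρ : 0 < ρ) (hball : closedBall p ρ ⊆ Ω) (hτ : 0 < τ)
    (hτt : τ < t) (htT : t < T) (hpq : ‖q - p‖ ≤ ρ / 4) (hp : m < u p τ) : m < u q t := by
  have hQ : IsOpen (pcyl Ω T) := hΩ.prod isOpen_Ioo
  have hpQ : (p, τ) ∈ pcyl Ω T := ⟨hball (mem_closedBall_self hρ.le), hτ, hτt.trans htT⟩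
  obtain ⟨c, hc, hcu⟩ : ∃ c, 0 < c ∧ m + c < u p τ := ⟨(u p τ - m) / 2, by linarith, by linarith⟩
  have hev : ∀ᶠ x in nhds p, m + c < u x τ := by
    have h := hlsc (p, τ) hpQ (m + c) hcu
    rw [hQ.nhdsWithin_eq hpQ] at h
    exact (Continuous.prodMk_left τ).continuousAt.eventually h
  obtain ⟨r₀, hr₀, hinit⟩ := Metric.nhds_basis_closedBall.eventually_iff.1 hev
  set r := min r₀ (ρ / 4) with hr
  obtain ⟨t₁, htt₁, ht₁⟩ := exists_between (lt_min htT (show t < 2 * t - τ by linarith))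
  have ht₁T : t₁ < T := ht₁.trans_le (min_le_left _ _)
  have ht₁2 : t₁ < 2 * t - τ := ht₁.trans_le (min_le_right _ _)
  have hd : 0 < t - τ := sub_pos.2 hτt
  have hfinal := hsuper.lt_of_moving_ball hA hB hC hlsc hm (p := p) (v := (t - τ)⁻¹ • (q - p))
    (τ := τ) (t₁ := t₁) (r := r) (lt_min hr₀ (by linarith)) hc
    (fun x hx => (hinit (by
      rw [mem_closedBall, dist_eq_norm]
      exact hx.trans (min_le_left _ _))).le)
    (fun x s hs1 hs2 hx => by
      refine ⟨hball ?_, hτ.trans_le hs1, hs2.trans_lt ht₁T⟩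
      have h1 : ‖(s - τ) • (t - τ)⁻¹ • (q - p)‖ ≤ 2 * (ρ / 4) := by
        rw [smul_smul, norm_smul, Real.norm_of_nonneg (mul_nonneg (by linarith) (by positivity))]
        refine mul_le_mul ?_ hpq (norm_nonneg _) (by norm_num)
        rw [← div_eq_mul_inv, div_le_iff₀ hd]
        linarith
      have h2 : r ≤ ρ / 4 := min_le_right _ _
      rw [mem_closedBall, dist_eq_norm]
      calc ‖x - p‖ = ‖(x - (p + (s - τ) • (t - τ)⁻¹ • (q - p))) +
            (s - τ) • (t - τ)⁻¹ • (q - p)‖ := by congr 1; abel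
        _ ≤ _ := norm_add_le _ _
        _ ≤ ρ := by linarith)
    hτt.le htt₁
  simpa [smul_smul, hd.ne'] using hfinal

/-- Positivity of `u - m` at a point spreads to the whole domain at every later time. -/
lemma ParSuper.lt_of_isPreconnected {H : En n → Sym n → ℝ} (hA : CondA H) (hB : CondB H 0)
    (hC : CondC H) {Ω : Set (En n)} (hΩ : IsOpen Ω) (hΩc : IsPreconnected Ω) {T : ℝ}
    {u : En n → ℝ → ℝ} {m : ℝ}
    (hlsc : LowerSemicontinuousOn (fun p : En n × ℝ => u p.1 p.2) (pcyl Ω T))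
    (hsuper : ParSuper H 1 (pcyl Ω T) u) (hm : ∀ x t, (x, t) ∈ pcyl Ω T → m ≤ u x t)
    {p x : En n} {τ t : ℝ} (hp : p ∈ Ω) (hτ : 0 < τ) (hpτ : m < u p τ) (hx : x ∈ Ω)
    (hτt : τ < t) (htT : t < T) : m < u x t := by
  set S : Set (En n) := {x | x ∈ Ω ∧ ∀ t, τ < t → t < T → m < u x t} with hS
  have hradius : ∀ x ∈ Ω, ∃ ρ > 0, closedBall x ρ ⊆ Ω := fun x hx =>
    Metric.nhds_basis_closedBall.mem_iff.1 (hΩ.mem_nhds hx)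
  have hstep : ∀ x y ρ, 0 < ρ → closedBall x ρ ⊆ Ω → x ∈ S → ‖y - x‖ ≤ ρ / 4 → y ∈ S := by
    intro x y ρ hρ hball hxS hxy
    refine ⟨hball ?_, fun t ht htT => ?_⟩
    · rw [mem_closedBall, dist_eq_norm]
      linarith
    · obtain ⟨t', h1, h2⟩ := exists_between ht
      exact hsuper.lt_of_dist_le hA hB hC hΩ hlsc hm hρ hball (hτ.trans h1) h2 htT hxy
        (hxS.2 t' h1 (h2.trans htT))
  have hpS : p ∈ S := by
    obtain ⟨ρ, hρ, hball⟩ := hradius p hp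
    exact ⟨hp, fun t ht htT => hsuper.lt_of_dist_le hA hB hC hΩ hlsc hm hρ hball hτ ht htT
      (by simpa using by positivity) hpτ⟩
  have hopen : IsOpen S := by
    refine Metric.isOpen_iff.2 fun x hxS => ?_
    obtain ⟨ρ, hρ, hball⟩ := hradius x hxS.1
    refine ⟨ρ / 4, by positivity, fun y hy => hstep x y ρ hρ hball hxS ?_⟩
    rw [← dist_eq_norm]
    exact (mem_ball.1 hy).le
  have hclosed : ∀ x ∈ Ω, x ∈ closure S → x ∈ S := by
    intro x hx hxS
    obtain ⟨ρ, hρ, hball⟩ := hradius x hx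
    obtain ⟨y, hyS, hxy⟩ := Metric.mem_closure_iff.1 hxS (ρ / 8) (by positivity)
    refine hstep y x (ρ / 2) (by positivity) (Subset.trans ?_ hball) hyS ?_
    · refine closedBall_subset_closedBall' ?_
      rw [dist_comm]
      linarith
    · rw [← dist_eq_norm]
      linarith
  have hsub : Ω ⊆ S := hΩc.subset_of_closure_inter_subset hopen ⟨p, hp, hpS⟩
    fun x hx => hclosed x hx.2 hx.1
  exact (hsub hx).2 t hτt htT

/-- Strong minimum principle for Γ₁ (k = 1). -/
theorem strong_minimum_principle_k_one
    {n : ℕ} (hn : 2 ≤ n)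
    (H : En n → Sym n → ℝ)
    (hA : CondA H) (hB : CondB H 0) (hC : CondC H)
    (Ω : Set (En n)) (hΩo : IsOpen Ω) (hΩc : IsConnected Ω)
    (hΩb : Bornology.IsBounded Ω)
    (T : ℝ) (hT : 0 < T)
    (u : En n → ℝ → ℝ)
    (hlsc : LowerSemicontinuousOn (fun p : En n × ℝ => u p.1 p.2) (pcyl Ω T))
    (hsuper : ParSuper H 1 (pcyl Ω T) u)
    (m : ℝ)
    (hbdd : BddBelow ((fun p : En n × ℝ => u p.1 p.2) '' pcyl Ω T))
    (hm : m = sInf ((fun p : En n × ℝ => u p.1 p.2) '' pcyl Ω T)) :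
    (∀ p τ, (p, τ) ∈ pcyl Ω T → m < u p τ →
      ∀ x t, x ∈ Ω → τ < t → t < T → m < u x t) ∧
    (∀ p τ, (p, τ) ∈ pcyl Ω T → u p τ = m →
      ∀ x t, x ∈ Ω → 0 < t → t < τ → u x t = m) := by
  have hle : ∀ x t, (x, t) ∈ pcyl Ω T → m ≤ u x t := fun x t hxt =>
    hm ▸ csInf_le hbdd ⟨(x, t), hxt, rfl⟩
  have hpos : ∀ p τ, (p, τ) ∈ pcyl Ω T → m < u p τ →
      ∀ x t, x ∈ Ω → τ < t → t < T → m < u x t := fun p τ hp hpτ x t hx ht htT =>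
    hsuper.lt_of_isPreconnected hA hB hC hΩo hΩc.isPreconnected hlsc hle hp.1 hp.2.1 hpτ hx ht htT
  refine ⟨hpos, fun p τ hp hpτ x t hx ht htτ => ?_⟩
  have hxt : (x, t) ∈ pcyl Ω T := ⟨hx, ht, htτ.trans hp.2.2⟩
  refine le_antisymm (not_lt.1 fun hlt => ?_) (hle x t hxt)
  exact (hpos x t hxt hlt p τ hp.1 htτ hp.2.2).ne' hpτ

end DNLP
end
end

section
/- Let n ≥ 2, let Ω ⊂ ℝ^n be a bounded domain, 0 < T < ∞, and let H satisfy Conditions A, B, C with k > 1. Let u be lower semicontinuous on Ω_T with u > 0, a viscosity supersolution of Γ_k[u] = H(Du,D²u) − u^{k−1}u_t = 0 in Ω_T, and set m = inf_{Ω_T} u. Assume m > 0. If (p,τ) ∈ Ω_T satisfies u(p,τ) > m, then there exists ρ > 0 such that u(x,t) > m for every (x,t) in the cylinder B_ρ(p) × [τ, T). Consequently, if u(p,τ) = m then u(p,s) = m for all 0 < s < τ. -/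
open Set Filter Metric

noncomputable section

namespace DNLP

variable {n : ℕ}

/-- The bump profile `x ↦ m + a (R² - |x - p|²)²` has gradient `-4a (R² - |y - p|²) (y - p)`. -/
theorem hasGradientAt_bump (p : En n) (m a R : ℝ) (y : En n) :
    HasGradientAt (fun x : En n => m + a * (R ^ 2 - ‖x - p‖ ^ 2) ^ 2)
      ((-(4 * a * (R ^ 2 - ‖y - p‖ ^ 2))) • (y - p)) y := by
  have h1 : HasFDerivAt (fun x : En n => x - p) (ContinuousLinearMap.id ℝ (En n)) y :=
    (hasFDerivAt_id y).sub_const p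
  have h2 := (((h1.norm_sq.const_sub (R ^ 2)).pow 2).const_mul a).const_add m
  rw [hasGradientAt_iff_hasFDerivAt]
  refine h2.congr_fderiv ?_
  ext v
  simp
  ring

theorem gradient_bump (p : En n) (m a R : ℝ) (y : En n) :
    gradient (fun x : En n => m + a * (R ^ 2 - ‖x - p‖ ^ 2) ^ 2) y
      = (-(4 * a * (R ^ 2 - ‖y - p‖ ^ 2))) • (y - p) :=
  (hasGradientAt_bump p m a R y).gradient

theorem ehess_bump (p : En n) (m a R : ℝ) (y : En n) :
    ehess (fun x : En n => m + a * (R ^ 2 - ‖x - p‖ ^ 2) ^ 2) y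
      = (8 * a) • vouter (y - p) (y - p) - (4 * a * (R ^ 2 - ‖y - p‖ ^ 2)) • (1 : Sym n) := by
  ext i j
  have hfun : (fun x : En n => fderiv ℝ (fun x : En n => m + a * (R ^ 2 - ‖x - p‖ ^ 2) ^ 2) x
      (EuclideanSpace.single j (1 : ℝ))) =
      fun x : En n => (-4 * a) * ((R ^ 2 - ‖x - p‖ ^ 2) *
        inner ℝ (x - p) (EuclideanSpace.single j (1 : ℝ))) := by
    funext x
    rw [(hasGradientAt_bump p m a R x).hasFDerivAt.fderiv]
    simp only [InnerProductSpace.toDual_apply_apply, inner_smul_left, conj_trivial]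
    ring
  have h1 : HasFDerivAt (fun x : En n => x - p) (ContinuousLinearMap.id ℝ (En n)) y :=
    (hasFDerivAt_id y).sub_const p
  have h2 := ((h1.norm_sq.const_sub (R ^ 2)).fun_mul
    (h1.inner ℝ (hasFDerivAt_const (EuclideanSpace.single j (1 : ℝ)) y))).const_mul (-4 * a)
  simp only [ehess, Matrix.of_apply]
  rw [hfun, HasFDerivAt.fderiv h2]
  by_cases hij : i = j
  · subst hij
    simp [vouter, EuclideanSpace.inner_single_right]
    ring
  · have hji : j ≠ i := fun h => hij h.symm
    simp [vouter, EuclideanSpace.inner_single_right, hij, hji]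
    ring

/-- Near the edge of its support the bump is a strict elliptic subsolution. -/
theorem CondC.bump_edge_pos {H : En n → Sym n → ℝ} {k₁ Λ₁ : ℝ} (hB : CondB H k₁)
    (hΛ₁ : 1 ≤ Λ₁)
    (hΛ : ∀ Λ : ℝ, Λ₁ ≤ Λ → ∀ e : En n, ‖e‖ = 1 → 0 < H e (Λ • vouter e e - 1))
    {z : En n} {a s : ℝ} (ha : 0 < a) (hs : 0 < s) (h : Λ₁ * s ≤ 2 * ‖z‖ ^ 2) :
    0 < H ((-(4 * a * s)) • z) ((8 * a) • vouter z z - (4 * a * s) • (1 : Sym n)) := by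
  have hz : 0 < ‖z‖ := by
    rcases (norm_nonneg z).eq_or_lt with h0 | h0
    · rw [← h0] at h; nlinarith
    · exact h0
  set e : En n := ‖z‖⁻¹ • z with he
  have hze : z = ‖z‖ • e := by rw [he, smul_smul, mul_inv_cancel₀ hz.ne', one_smul]
  have hen : ‖e‖ = 1 := by
    rw [he, norm_smul, norm_inv, norm_norm, inv_mul_cancel₀ hz.ne']
  have hX : (8 * a) • vouter z z - (4 * a * s) • (1 : Sym n)
      = (4 * a * s) • ((2 * ‖z‖ ^ 2 / s) • vouter e e - 1) := by
    ext i j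
    have hzi : ∀ i, z i = ‖z‖ * e i := fun i => by
      conv_lhs => rw [hze]
      simp
    simp only [vouter, Matrix.sub_apply, Matrix.smul_apply, Matrix.of_apply, smul_eq_mul, hzi]
    field_simp
    ring
  have hp : (-(4 * a * s)) • z = (-(4 * a * s) * ‖z‖) • e := by
    conv_lhs => rw [hze]
    rw [smul_smul]
  rw [hX, hp, hB.2.1, hB.2.2 _ (by positivity)]
  have h1 := hΛ (2 * ‖z‖ ^ 2 / s) ((le_div_iff₀ hs).2 h) e hen
  have h2 : -(4 * a * s) * ‖z‖ ≠ 0 := by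
    have : 0 < 4 * a * s * ‖z‖ := by positivity
    linarith
  have := Real.rpow_pos_of_pos (abs_pos.2 h2) k₁
  positivity

theorem bump_lower_bound {H : En n → Sym n → ℝ} {k₁ : ℝ} (hA : CondA H) (hB : CondB H k₁)
    {z : En n} {a s C : ℝ} (ha : 0 < a) (hs : 0 < s) (hC : -C ≤ H z (-1)) :
    -C * ((4 * a * s) ^ k₁ * (4 * a * s)) ≤
      H ((-(4 * a * s)) • z) ((8 * a) • vouter z z - (4 * a * s) • (1 : Sym n)) := by
  have hpos : 0 < 4 * a * s := by positivity
  have hmono : LoewnerLE ((4 * a * s) • (-1 : Sym n))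
      ((8 * a) • vouter z z - (4 * a * s) • (1 : Sym n)) := by
    have hv : vouter z z = Matrix.vecMulVec (z : Fin n → ℝ) (star (z : Fin n → ℝ)) := by
      ext i j
      simp [vouter, Matrix.vecMulVec_apply]
    have : (8 * a) • vouter z z - (4 * a * s) • (1 : Sym n) - (4 * a * s) • (-1 : Sym n)
        = (8 * a) • vouter z z := by
      simp
    rw [LoewnerLE, this, hv]
    exact (Matrix.posSemidef_vecMulVec_self_star _).smul (by positivity)
  refine le_trans ?_ (hA.2.2 _ _ _ hmono)
  rw [hB.2.1, hB.2.2 _ hpos, abs_neg, abs_of_pos hpos]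
  have : 0 ≤ (4 * a * s) ^ k₁ * (4 * a * s) := by positivity
  nlinarith

set_option maxHeartbeats 1000000 in
/-- A positive spatial lower bound at time `τ` on a ball propagates to later times. -/
theorem ParSuper.lt_of_lt_on_closedBall {H : En n → Sym n → ℝ} {k₁ : ℝ}
    (hA : CondA H) (hB : CondB H k₁) (hC : CondC H)
    {Ω : Set (En n)} {T m δ R τ t : ℝ} {p x : En n} {u : En n → ℝ → ℝ}
    (hlsc : LowerSemicontinuousOn (fun p : En n × ℝ => u p.1 p.2) (pcyl Ω T))
    (hsuper : ParSuper H (k₁ + 1) (pcyl Ω T) u)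
    (hmu : ∀ q ∈ pcyl Ω T, m ≤ u q.1 q.2) (hm : 0 < m) (hδ : 0 < δ) (hR : 0 < R)
    (hRΩ : closedBall p R ⊆ Ω) (hτ : 0 < τ)
    (hinit : ∀ y ∈ closedBall p R, m + δ ≤ u y τ)
    (hx : x ∈ ball p R) (hτt : τ ≤ t) (htT : t < T) : m < u x t := by
  obtain ⟨-, Λ₁, hΛ₁, hΛ⟩ := hC
  obtain ⟨S, htS, hST⟩ := exists_between htT
  have hτS : 0 < S - τ := by linarith
  -- a uniform bound for the elliptic operator on the ball
  obtain ⟨C, hC0, hCb⟩ : ∃ C : ℝ, 0 ≤ C ∧ ∀ z ∈ closedBall (0 : En n) R, -C ≤ H z (-1) := by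
    have hcont : Continuous fun z : En n => H z (-1) :=
      hA.1.comp (continuous_id.prodMk continuous_const)
    obtain ⟨b, hb⟩ := ((isCompact_closedBall (0 : En n) R).image hcont).bddBelow
    refine ⟨|b|, abs_nonneg b, fun z hz => ?_⟩
    have := hb (mem_image_of_mem _ hz)
    linarith [neg_abs_le b]
  set a₀ : ℝ := δ / (R ^ 4 * (S - τ)) with ha₀
  have ha₀pos : 0 < a₀ := by positivity
  set A : ℝ := a₀ * (S - τ) with hAdef
  have hApos : 0 < A := by positivity
  set s₀ : ℝ := 2 * R ^ 2 / (2 + Λ₁) with hs₀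
  have hs₀pos : 0 < s₀ := by positivity
  set K : ℝ := 4 * C * (4 * A * R ^ 2) ^ k₁ / (s₀ * m ^ k₁) with hK
  have hmk : 0 < m ^ k₁ := Real.rpow_pos_of_pos hm _
  have hK0 : 0 ≤ K := by positivity
  set a : ℝ → ℝ := fun r => a₀ * (Real.exp (-K * (r - τ)) * (S - r)) with ha
  have hader : ∀ r, HasDerivAt a (-K * a r - a₀ * Real.exp (-K * (r - τ))) r := by
    intro r
    have h1 : HasDerivAt (fun r : ℝ => -K * (r - τ)) (-K * 1) r :=
      ((hasDerivAt_id r).sub_const τ).const_mul (-K)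
    have h2 : HasDerivAt (fun r : ℝ => S - r) (-1) r := (hasDerivAt_id r).const_sub S
    refine ((h1.exp.mul h2).const_mul a₀).congr_deriv ?_
    simp only [ha]
    ring
  have hapos : ∀ r, r < S → 0 < a r := fun r hr => by
    have : 0 < S - r := by linarith
    positivity
  have haA : ∀ r, τ ≤ r → r ≤ S → a r ≤ A := fun r h1 h2 => by
    have h3 : Real.exp (-K * (r - τ)) ≤ 1 := by
      rw [Real.exp_le_one_iff]
      nlinarith
    have h4 := (Real.exp_pos (-K * (r - τ))).le
    have : Real.exp (-K * (r - τ)) * (S - r) ≤ 1 * (S - τ) :=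
      mul_le_mul h3 (by linarith) (by linarith) zero_le_one
    simp only [ha, hAdef]
    nlinarith
  have haS : a S = 0 := by simp [ha]
  set ψ : En n → ℝ → ℝ := fun x r => m + a r * (R ^ 2 - ‖x - p‖ ^ 2) ^ 2 with hψ
  have hψtest : IsTestFn ψ := by
    refine ⟨fun r => ?_, fun y => ?_⟩
    · have : ContDiff ℝ 2 fun x : En n => ‖x - p‖ ^ 2 :=
        (contDiff_id.sub contDiff_const).norm_sq ℝ
      exact contDiff_const.add (contDiff_const.mul ((contDiff_const.sub this).pow 2))
    · simp only [hψ, ha]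
      fun_prop
  have hψcont : Continuous fun q : En n × ℝ => ψ q.1 q.2 := by
    simp only [hψ, ha]
    fun_prop
  -- comparison on the compact cylinder
  have hsub : closedBall p R ×ˢ Icc τ S ⊆ pcyl Ω T := fun q hq =>
    ⟨hRΩ hq.1, lt_of_lt_of_le hτ hq.2.1, lt_of_le_of_lt hq.2.2 hST⟩
  have hcomp : IsCompact (closedBall p R ×ˢ Icc τ S) :=
    (isCompact_closedBall p R).prod isCompact_Icc
  have hlsc' : LowerSemicontinuousOn (fun q : En n × ℝ => u q.1 q.2 - ψ q.1 q.2)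
      (closedBall p R ×ˢ Icc τ S) := by
    simp only [sub_eq_add_neg]
    exact (hlsc.mono hsub).add hψcont.neg.continuousOn.lowerSemicontinuousOn
  have hxt : (x, t) ∈ closedBall p R ×ˢ Icc τ S :=
    ⟨ball_subset_closedBall hx, hτt, htS.le⟩
  obtain ⟨⟨y, r⟩, hyr, hmin⟩ := hlsc'.exists_isMinOn ⟨_, hxt⟩ hcomp
  have hkey : 0 ≤ u y r - ψ y r := by
    by_contra! hneg
    have hyrQ := hsub hyr
    have hum : m ≤ u y r := hmu _ hyrQ
    obtain ⟨hyR, hrτ, hrS⟩ := hyr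
    simp only at hyR hrτ hrS
    have hynorm : ‖y - p‖ ≤ R := mem_closedBall_iff_norm.1 hyR
    have hrS' : r < S := by
      refine lt_of_le_of_ne hrS fun h => ?_
      subst h
      simp only [hψ, haS] at hneg
      linarith
    have hyR' : ‖y - p‖ < R := by
      refine lt_of_le_of_ne hynorm fun h => ?_
      simp only [hψ, h] at hneg
      simp at hneg
      linarith
    have hs : 0 < R ^ 2 - ‖y - p‖ ^ 2 := by nlinarith [norm_nonneg (y - p)]
    have hsR : R ^ 2 - ‖y - p‖ ^ 2 ≤ R ^ 2 := by nlinarith [norm_nonneg (y - p)]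
    have hrτ' : τ < r := by
      refine lt_of_le_of_ne hrτ fun h => ?_
      subst h
      have h1 := hinit y hyR
      have h2 : (R ^ 2 - ‖y - p‖ ^ 2) ^ 2 ≤ R ^ 4 := by nlinarith
      have h3 : a τ * R ^ 4 = δ := by
        simp only [ha, ha₀, sub_self, mul_zero, Real.exp_zero, one_mul]
        field_simp
      have h4 := mul_le_mul_of_nonneg_left h2 (hapos τ hrS').le
      simp only [hψ] at hneg
      linarith
    have hnhds : closedBall p R ×ˢ Icc τ S ∈ nhds (y, r) := by
      refine prod_mem_nhds ?_ (Icc_mem_nhds hrτ' hrS')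
      exact mem_of_superset (isOpen_ball.mem_nhds (mem_ball_iff_norm.2 hyR'))
        ball_subset_closedBall
    have hvisc := hsuper ψ hψtest y r hyrQ ((hmin.isLocalMin hnhds).on _)
    have hgrad : sgrad ψ y r = _ := gradient_bump p m (a r) R y
    have hhess : shess ψ y r = _ := ehess_bump p m (a r) R y
    have htime : tpartial ψ y r = (-K * a r - a₀ * Real.exp (-K * (r - τ))) *
        (R ^ 2 - ‖y - p‖ ^ 2) ^ 2 :=
      (((hader r).mul_const _).const_add m).deriv
    rw [hgrad, hhess, htime, add_sub_cancel_right] at hvisc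
    have huk : m ^ k₁ ≤ u y r ^ k₁ := Real.rpow_le_rpow hm.le hum hB.1
    have hz : y - p ∈ closedBall (0 : En n) R := by simpa using hynorm
    generalize hzdef : y - p = z at *
    generalize hsdef : R ^ 2 - ‖z‖ ^ 2 = s at *
    have har := hapos r hrS'
    have haAr := haA r hrτ hrS
    generalize a r = b at *
    have hexp : 0 < a₀ * Real.exp (-K * (r - τ)) := by positivity
    generalize a₀ * Real.exp (-K * (r - τ)) = E at *
    generalize u y r ^ k₁ = U at *
    have hU : 0 < U := lt_of_lt_of_le hmk huk
    have hUE : 0 < U * E * s ^ 2 := by positivity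
    have hexpand : U * ((-K * b - E) * s ^ 2) = -(K * s * U * (b * s)) - U * E * s ^ 2 := by ring
    rcases le_or_gt (Λ₁ * s) (2 * ‖z‖ ^ 2) with hcase | hcase
    · have h1 := CondC.bump_edge_pos hB hΛ₁ (fun Λ h e he => (hΛ Λ h e he).2) har hs hcase
      have h2 : 0 ≤ K * s * U * (b * s) := by positivity
      linarith
    · have h1 := bump_lower_bound hA hB har hs (hCb z hz)
      have hss : s₀ ≤ s := by
        rw [hs₀, div_le_iff₀ (by positivity)]
        nlinarith
      have h2 : (4 * b * s) ^ k₁ ≤ (4 * A * R ^ 2) ^ k₁ := by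
        refine Real.rpow_le_rpow (by positivity) ?_ hB.1
        have : b * s ≤ A * R ^ 2 := mul_le_mul haAr hsR hs.le hApos.le
        linarith
      have h3 : C * ((4 * b * s) ^ k₁ * (4 * b * s)) ≤
          C * ((4 * A * R ^ 2) ^ k₁ * (4 * b * s)) := by gcongr
      have h4 : C * ((4 * A * R ^ 2) ^ k₁ * (4 * b * s)) = K * s₀ * m ^ k₁ * (b * s) := by
        rw [hK]
        field_simp
      have h5 : K * s₀ * m ^ k₁ * (b * s) ≤ K * s * U * (b * s) := by gcongr
      rw [neg_mul] at h1
      linarith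
  have hxmin : u y r - ψ y r ≤ u x t - ψ x t := hmin hxt
  have hxR : ‖x - p‖ < R := mem_ball_iff_norm.1 hx
  have hsx : 0 < R ^ 2 - ‖x - p‖ ^ 2 := by nlinarith [norm_nonneg (x - p)]
  have : 0 < a t * (R ^ 2 - ‖x - p‖ ^ 2) ^ 2 := mul_pos (hapos t htS) (by positivity)
  simp only [hψ] at hxmin hkey
  linarith

/-- weak form of the strong minimum principle for Γ_k, k > 1, when m > 0. -/
theorem strong_minimum_principle_k_gt_one
    {n : ℕ} (hn : 2 ≤ n)
    (H : En n → Sym n → ℝ) (k₁ k : ℝ) (hk : k = k₁ + 1) (hkk : 1 < k)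
    (hA : CondA H) (hB : CondB H k₁) (hC : CondC H)
    (Ω : Set (En n)) (hΩo : IsOpen Ω) (hΩc : IsConnected Ω)
    (hΩb : Bornology.IsBounded Ω)
    (T : ℝ) (hT : 0 < T)
    (u : En n → ℝ → ℝ)
    (hupos : ∀ q ∈ pcyl Ω T, 0 < u q.1 q.2)
    (hlsc : LowerSemicontinuousOn (fun p : En n × ℝ => u p.1 p.2) (pcyl Ω T))
    (hsuper : ParSuper H k (pcyl Ω T) u)
    (m : ℝ)
    (hbdd : BddBelow ((fun p : En n × ℝ => u p.1 p.2) '' pcyl Ω T))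
    (hm : m = sInf ((fun p : En n × ℝ => u p.1 p.2) '' pcyl Ω T))
    (hmpos : 0 < m) :
    (∀ p τ, (p, τ) ∈ pcyl Ω T → m < u p τ →
      ∃ ρ : ℝ, 0 < ρ ∧ Metric.ball p ρ ⊆ Ω ∧
        ∀ x t, x ∈ Metric.ball p ρ → τ ≤ t → t < T → m < u x t) ∧
    (∀ p τ, (p, τ) ∈ pcyl Ω T → u p τ = m →
      ∀ s, 0 < s → s < τ → u p s = m) := by
  subst hk
  have hmu : ∀ q ∈ pcyl Ω T, m ≤ u q.1 q.2 := fun q hq =>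
    hm ▸ csInf_le hbdd (mem_image_of_mem _ hq)
  have hprop : ∀ p τ, (p, τ) ∈ pcyl Ω T → m < u p τ →
      ∃ ρ : ℝ, 0 < ρ ∧ Metric.ball p ρ ⊆ Ω ∧
        ∀ x t, x ∈ Metric.ball p ρ → τ ≤ t → t < T → m < u x t := by
    intro p τ hpτ hlt
    obtain ⟨c, hmc, hcu⟩ := exists_between hlt
    have hopen : IsOpen (pcyl Ω T) := hΩo.prod isOpen_Ioo
    have hev : ∀ᶠ q in nhds (p, τ), c < u q.1 q.2 := by
      have := hlsc (p, τ) hpτ c hcu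
      rwa [hopen.nhdsWithin_eq hpτ] at this
    have hev' : ∀ᶠ y in nhds p, c < u y τ ∧ y ∈ Ω :=
      ((Continuous.prodMk_left τ).tendsto p |>.eventually hev).and (hΩo.mem_nhds hpτ.1)
    obtain ⟨R, hR, hRsub⟩ := Metric.nhds_basis_closedBall.eventually_iff.1 hev'
    refine ⟨R, hR, fun y hy => (hRsub (ball_subset_closedBall hy)).2, ?_⟩
    intro x t hx hτt htT
    refine hsuper.lt_of_lt_on_closedBall hA hB hC hlsc hmu hmpos (sub_pos.2 hmc) hR
      (fun y hy => (hRsub hy).2) hpτ.2.1 (fun y hy => ?_) hx hτt htT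
    linarith [(hRsub hy).1]
  refine ⟨hprop, fun p τ hpτ hu s hs hsτ => ?_⟩
  have hps : (p, s) ∈ pcyl Ω T := ⟨hpτ.1, hs, hsτ.trans hpτ.2.2⟩
  by_contra hne
  obtain ⟨ρ, hρ, -, h⟩ := hprop p s hps (lt_of_le_of_ne (hmu _ hps) (Ne.symm hne))
  exact (h p τ (mem_ball_self hρ) hsτ.le hpτ.2.2).ne' hu

end DNLP
end
end

section
/- Let n ≥ 2, let Ω ⊂ ℝ^n be a bounded domain, 0 < T < ∞, and let H satisfy Conditions A, B, C with k > 1. Let u be continuous on Ω_T with u ≥ 0, a viscosity supersolution of Γ_k[u] = H(Du,D²u) − u^{k−1}u_t = 0 in Ω_T, and suppose inf_{Ω_T} u = 0. If (p,τ) ∈ Ω_T satisfies u(p,τ) = 0, then there exists a sequence of points (x_ℓ, t_ℓ) ∈ Ω_T with t_ℓ < τ, u(x_ℓ, t_ℓ) = 0 for every ℓ, and (x_ℓ, t_ℓ) → (p,τ); in particular the zeros of u are not isolated. -/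
open Set Filter Metric

noncomputable section

namespace DNLP

variable {n : ℕ}

theorem hasFDerivAt_quartic {n : ℕ} (c R : ℝ) (p x : En n) :
    HasFDerivAt (fun x : En n => c * (R - ‖x - p‖ ^ 2) ^ 2)
      ((-4 * c * (R - ‖x - p‖ ^ 2)) • innerSL ℝ (x - p)) x := by
  have h1 : HasFDerivAt (fun x : En n => ‖x - p‖ ^ 2) (2 • innerSL ℝ (x - p)) x := by
    simpa using ((hasFDerivAt_id x).sub_const p).norm_sq
  refine (((h1.const_sub R).pow 2).const_mul c).congr_fderiv ?_
  ext v
  simp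
  ring

theorem gradient_quartic {n : ℕ} (c R : ℝ) (p x : En n) :
    gradient (fun x : En n => c * (R - ‖x - p‖ ^ 2) ^ 2) x
      = c • ((-4 * (R - ‖x - p‖ ^ 2)) • (x - p)) := by
  apply HasGradientAt.gradient
  rw [hasGradientAt_iff_hasFDerivAt]
  refine (hasFDerivAt_quartic c R p x).congr_fderiv ?_
  ext v
  simp
  ring

theorem hessian_quartic {n : ℕ} (c R : ℝ) (p y : En n) :
    (Matrix.of fun i j =>
      fderiv ℝ (fun x => fderiv ℝ (fun x' : En n => c * (R - ‖x' - p‖ ^ 2) ^ 2) x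
        (EuclideanSpace.single j (1:ℝ))) y (EuclideanSpace.single i (1:ℝ)))
      = c • ((8:ℝ) • vouter (y - p) (y - p) - (4 * (R - ‖y - p‖ ^ 2)) • (1 : Sym n)) := by
  ext i j
  have h0 : (fun x => fderiv ℝ (fun x' : En n => c * (R - ‖x' - p‖ ^ 2) ^ 2) x
        (EuclideanSpace.single j (1:ℝ)))
      = fun x => (-4 * c * (R - ‖x - p‖ ^ 2)) * (x - p) j := by
    funext x
    rw [(hasFDerivAt_quartic c R p x).fderiv]
    simp [EuclideanSpace.inner_single_right]
  have h1 : HasFDerivAt (fun x : En n => ‖x - p‖ ^ 2) (2 • innerSL ℝ (y - p)) y := by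
    simpa using ((hasFDerivAt_id y).sub_const p).norm_sq
  have h2 : HasFDerivAt (fun x : En n => (x - p) j) (EuclideanSpace.proj j : En n →L[ℝ] ℝ) y := by
    simpa using (EuclideanSpace.proj (𝕜 := ℝ) j).hasFDerivAt.sub_const (p j)
  have h3 := ((h1.const_sub R).const_mul (-4 * c)).mul h2
  have h4 : fderiv ℝ (fun x : En n => (-4 * c * (R - ‖x - p‖ ^ 2)) * (x - p) j) y = _ := h3.fderiv
  rw [Matrix.of_apply, h0, h4]
  by_cases hij : i = j
  · subst hij
    simp [EuclideanSpace.inner_single_right, vouter]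
    ring
  · have hji : j ≠ i := fun h => hij h.symm
    simp [EuclideanSpace.inner_single_right, vouter, hij, hji]
    ring

/-- The value of `H` at the gradient and Hessian of `x ↦ (R - ‖x - p‖²)²`, as a function of
`z = x - p`. -/
def quarticValue {n : ℕ} (H : En n → Sym n → ℝ) (R : ℝ) (z : En n) : ℝ :=
  H ((-4 * (R - ‖z‖ ^ 2)) • z) ((8:ℝ) • vouter z z - (4 * (R - ‖z‖ ^ 2)) • (1 : Sym n))

theorem continuous_quarticValue {n : ℕ} {H : En n → Sym n → ℝ} (hA : CondA H) (R : ℝ) :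
    Continuous (quarticValue H R) := by
  have hv : Continuous fun z : En n => vouter z z := by
    refine continuous_matrix fun i j => ?_
    simp only [vouter, Matrix.of_apply]
    fun_prop
  have : Continuous fun z : En n => ((-4 * (R - ‖z‖ ^ 2)) • z,
      (8:ℝ) • vouter z z - (4 * (R - ‖z‖ ^ 2)) • (1 : Sym n)) := by
    fun_prop
  exact hA.1.comp this

theorem quarticValue_pos {n : ℕ} {H : En n → Sym n → ℝ} {k₁ Λ₁ R : ℝ} (hB : CondB H k₁)
    (hΛ : ∀ Λ : ℝ, Λ₁ ≤ Λ → ∀ e : En n, ‖e‖ = 1 → 0 < H e (Λ • vouter e e - 1))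
    {z : En n} (hz : z ≠ 0) (hR : 0 < R - ‖z‖ ^ 2)
    (h : Λ₁ * (R - ‖z‖ ^ 2) ≤ 2 * ‖z‖ ^ 2) :
    0 < quarticValue H R z := by
  obtain ⟨-, hB1, hB2⟩ := hB
  set s := R - ‖z‖ ^ 2 with hs
  have hzn : 0 < ‖z‖ := norm_pos_iff.2 hz
  set e : En n := ‖z‖⁻¹ • z with he
  have hen : ‖e‖ = 1 := by
    rw [he, norm_smul, norm_inv, norm_norm, inv_mul_cancel₀ hzn.ne']
  have hze : z = ‖z‖ • e := by rw [he, smul_smul, mul_inv_cancel₀ hzn.ne', one_smul]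
  have hX : (8:ℝ) • vouter z z - (4 * s) • (1 : Sym n)
      = (4 * s) • ((2 * ‖z‖ ^ 2 / s) • vouter e e - 1) := by
    ext i j
    have hi : z i = ‖z‖ * e i := by simpa using congrArg (fun w : En n => w i) hze
    have hj : z j = ‖z‖ * e j := by simpa using congrArg (fun w : En n => w j) hze
    simp only [vouter, Matrix.sub_apply, Matrix.smul_apply, Matrix.of_apply, smul_eq_mul]
    rw [hi, hj]
    field_simp
    ring
  have hp : (-4 * s) • z = (-4 * s * ‖z‖) • e := by
    conv_lhs => rw [hze]
    rw [smul_smul]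
  rw [quarticValue, ← hs, hX, hp, hB1, hB2 _ (by positivity)]
  have h1 : 0 < |(-4 * s * ‖z‖)| := abs_pos.2 (by
    have : 0 < s * ‖z‖ := by positivity
    nlinarith)
  exact mul_pos (Real.rpow_pos_of_pos h1 _)
    (mul_pos (by positivity) (hΛ _ ((le_div_iff₀ hR).2 h) e hen))

theorem exists_quarticValue_add_pos {n : ℕ} {H : En n → Sym n → ℝ} {k₁ : ℝ} (k : ℝ) {r : ℝ}
    (hr : 0 < r) (hA : CondA H) (hB : CondB H k₁) (hC : CondC H) :
    ∃ L : ℝ, 0 ≤ L ∧ ∀ z : En n, ‖z‖ < r →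
      0 < quarticValue H (r ^ 2) z + L * ((r ^ 2 - ‖z‖ ^ 2) ^ 2) ^ k := by
  obtain ⟨-, Λ₁, hΛ1, hΛ⟩ := hC
  have hcont : Continuous fun z : En n => quarticValue H (r ^ 2) z :=
    continuous_quarticValue hA _
  set c : ℝ := 2 * r ^ 2 / (Λ₁ + 2) with hc
  have hc0 : 0 < c := by positivity
  have hcr : c * (Λ₁ + 2) = 2 * r ^ 2 := by rw [hc]; field_simp
  set K : Set (En n) := closedBall 0 r ∩ {z | c ≤ r ^ 2 - ‖z‖ ^ 2} with hK
  have hKc : IsCompact K := (isCompact_closedBall _ _).inter_right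
    (isClosed_le continuous_const (by fun_prop))
  have hcontw : ContinuousOn
      (fun z : En n => -quarticValue H (r ^ 2) z / ((r ^ 2 - ‖z‖ ^ 2) ^ 2) ^ k) K := by
    refine hcont.neg.continuousOn.div ?_ ?_
    · refine ContinuousOn.rpow_const (by fun_prop) fun z hz => Or.inl ?_
      have : 0 < r ^ 2 - ‖z‖ ^ 2 := hc0.trans_le hz.2
      positivity
    · intro z hz
      have : 0 < r ^ 2 - ‖z‖ ^ 2 := hc0.trans_le hz.2
      positivity
  obtain ⟨L, hL⟩ := (hKc.image_of_continuousOn hcontw).bddAbove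
  refine ⟨max L 0 + 1, by positivity, fun z hz => ?_⟩
  have hs : 0 < r ^ 2 - ‖z‖ ^ 2 := by nlinarith [norm_nonneg z]
  have hφ : 0 < ((r ^ 2 - ‖z‖ ^ 2) ^ 2) ^ k := by positivity
  by_cases hzc : c ≤ r ^ 2 - ‖z‖ ^ 2
  · have h1 := hL (mem_image_of_mem _ (show z ∈ K from ⟨by simpa using hz.le, hzc⟩))
    rw [div_le_iff₀ hφ] at h1
    nlinarith [mul_le_mul_of_nonneg_right (le_max_left L 0) hφ.le]
  · push Not at hzc
    have hz0 : z ≠ 0 := by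
      rintro rfl
      simp only [norm_zero] at hzc
      nlinarith [sq_pos_of_pos hr]
    have := quarticValue_pos hB (fun Λ h e he => (hΛ Λ h e he).2) hz0 hs (by nlinarith)
    positivity

/-- The time factor `exp (-L t) (1 - exp (M (t - s)))`, which vanishes at `t = s`. -/
def timeFactor (L M s t : ℝ) : ℝ := Real.exp (-L * t) * (1 - Real.exp (M * (t - s)))

theorem hasDerivAt_timeFactor (L M s t : ℝ) :
    HasDerivAt (timeFactor L M s)
      (-L * timeFactor L M s t - Real.exp (-L * t) * (M * Real.exp (M * (t - s)))) t := by
  have h1 : HasDerivAt (fun t : ℝ => Real.exp (-L * t)) (Real.exp (-L * t) * (-L)) t := by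
    simpa using ((hasDerivAt_id t).const_mul (-L)).exp
  have h2 : HasDerivAt (fun t : ℝ => Real.exp (M * (t - s))) (Real.exp (M * (t - s)) * M) t := by
    simpa using (((hasDerivAt_id t).sub_const s).const_mul M).exp
  refine (h1.mul (h2.const_sub 1)).congr_deriv ?_
  simp only [timeFactor]
  ring

theorem contDiff_timeFactor (L M s : ℝ) : ContDiff ℝ 1 (timeFactor L M s) := by
  unfold timeFactor
  fun_prop

theorem timeFactor_pos {L M s t : ℝ} (hM : 0 < M) (ht : t < s) : 0 < timeFactor L M s t := by
  refine mul_pos (Real.exp_pos _) (sub_pos.2 (Real.exp_lt_one_iff.2 ?_))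
  nlinarith

/-- A supersolution cannot be touched from below, at a positive value, by a positive multiple of
`(r² - |x - p|²)² g(t)` when `g' ≤ -L g` and `L` is large. -/
theorem not_touch {n : ℕ} {H : En n → Sym n → ℝ} {k₁ k : ℝ} (hk : k = k₁ + 1)
    (hB : CondB H k₁) {Q : Set (En n × ℝ)} {u : En n → ℝ → ℝ} (hsuper : ParSuper H k Q u)
    {r L A g' : ℝ} {g : ℝ → ℝ} {p y : En n} {σ : ℝ}
    (hL : 0 < quarticValue H (r ^ 2) (y - p) + L * ((r ^ 2 - ‖y - p‖ ^ 2) ^ 2) ^ k)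
    (hA : 0 < A) (hg : ContDiff ℝ 1 g) (hgσ : 0 < g σ) (hg' : HasDerivAt g g' σ)
    (hgL : g' ≤ -L * g σ) (hφ : 0 < (r ^ 2 - ‖y - p‖ ^ 2) ^ 2) (hQ : (y, σ) ∈ Q)
    (hmin : IsLocalMinOn (fun q : En n × ℝ =>
      u q.1 q.2 - A * g q.2 * (r ^ 2 - ‖q.1 - p‖ ^ 2) ^ 2) Q (y, σ))
    (hu : u y σ = A * g σ * (r ^ 2 - ‖y - p‖ ^ 2) ^ 2) : False := by
  have htest : IsTestFn fun (x : En n) t => A * g t * (r ^ 2 - ‖x - p‖ ^ 2) ^ 2 := by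
    refine ⟨fun t => ?_, fun x => by fun_prop⟩
    have : ContDiff ℝ 2 fun x : En n => ‖x - p‖ ^ 2 := (contDiff_id.sub contDiff_const).norm_sq ℝ
    fun_prop
  have h := hsuper _ htest y σ hQ hmin
  have hc : 0 < A * g σ := mul_pos hA hgσ
  set φ := (r ^ 2 - ‖y - p‖ ^ 2) ^ 2 with hφdef
  have ht : tpartial (fun (x : En n) t => A * g t * (r ^ 2 - ‖x - p‖ ^ 2) ^ 2) y σ
      = A * g' * φ := ((hg'.const_mul A).mul_const _).deriv
  have hH : H (sgrad (fun (x : En n) t => A * g t * (r ^ 2 - ‖x - p‖ ^ 2) ^ 2) y σ)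
      (shess (fun (x : En n) t => A * g t * (r ^ 2 - ‖x - p‖ ^ 2) ^ 2) y σ)
      = (A * g σ) ^ k * quarticValue H (r ^ 2) (y - p) := by
    rw [sgrad, shess, gradient_quartic, hessian_quartic, hB.2.1, hB.2.2 _ hc, abs_of_pos hc, hk,
      Real.rpow_add_one hc.ne', quarticValue]
    ring
  rw [ht, hH, hu] at h
  have hpow : (A * g σ * φ) ^ (k - 1) * (A * g σ * φ) = (A * g σ) ^ k * φ ^ k := by
    rw [← Real.rpow_add_one (by positivity), sub_add_cancel, Real.mul_rpow hc.le hφ.le]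
  have hpos : 0 < (A * g σ * φ) ^ (k - 1) := by positivity
  have h1 : A * g' * φ ≤ -L * (A * g σ * φ) := by
    have := mul_le_mul_of_nonneg_left hgL (mul_pos hA hφ).le
    linarith
  have h2 := mul_le_mul_of_nonneg_left h1 hpos.le
  have h3 : 0 < (A * g σ) ^ k * (quarticValue H (r ^ 2) (y - p) + L * φ ^ k) :=
    mul_pos (by positivity) hL
  have h4 : (A * g σ * φ) ^ (k - 1) * (-L * (A * g σ * φ)) = -L * ((A * g σ) ^ k * φ ^ k) := by
    rw [← hpow]; ring
  linarith

/-- Positivity of a supersolution propagates forward in time. -/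
theorem pos_of_pos_before {n : ℕ} {H : En n → Sym n → ℝ} {k₁ k : ℝ} (hk : k = k₁ + 1)
    (hA : CondA H) (hB : CondB H k₁) (hC : CondC H) {Ω : Set (En n)} {T : ℝ}
    {u : En n → ℝ → ℝ} (hcont : ContinuousOn (fun q : En n × ℝ => u q.1 q.2) (pcyl Ω T))
    (hsuper : ParSuper H k (pcyl Ω T) u) {p : En n} {r t₀ τ : ℝ} (hr : 0 < r)
    (hrΩ : closedBall p r ⊆ Ω) (ht₀ : 0 < t₀) (htτ : t₀ < τ) (hτT : τ < T)
    (hpos : ∀ x ∈ closedBall p r, ∀ t ∈ Ico t₀ τ, 0 < u x t) : 0 < u p τ := by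
  obtain ⟨L, hL0, hL⟩ := exists_quarticValue_add_pos k hr hA hB hC
  have hp : p ∈ closedBall p r := mem_closedBall_self hr.le
  obtain ⟨m, hm, hmu⟩ : ∃ m > 0, ∀ x ∈ closedBall p r, m ≤ u x t₀ := by
    have hc0 : ContinuousOn (fun x => u x t₀) (closedBall p r) :=
      hcont.comp (f := fun x : En n => (x, t₀)) (by fun_prop)
        fun x hx => ⟨hrΩ hx, ht₀, htτ.trans hτT⟩
    obtain ⟨x₀, hx₀, hmin⟩ := (isCompact_closedBall p r).exists_isMinOn ⟨p, hp⟩ hc0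
    exact ⟨u x₀ t₀, hpos _ hx₀ _ ⟨le_rfl, htτ⟩, fun x hx => hmin hx⟩
  have key : ∀ t s M, t₀ ≤ t → t < s → s < τ → 0 < M →
      m * timeFactor L M s t ≤ u p t := by
    intro t s M h0t hts hsτ hM
    set g := timeFactor L M s with hg
    set K : Set (En n × ℝ) := closedBall p r ×ˢ Icc t₀ s with hK
    have hKc : IsCompact K := (isCompact_closedBall p r).prod isCompact_Icc
    have hKQ : K ⊆ pcyl Ω T := fun q hq =>
      ⟨hrΩ hq.1, ht₀.trans_le hq.2.1, (hq.2.2.trans_lt hsτ).trans hτT⟩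
    have hKpos : ∀ q ∈ K, 0 < u q.1 q.2 := fun q hq =>
      hpos _ hq.1 _ ⟨hq.2.1, hq.2.2.trans_lt hsτ⟩
    have hgc : Continuous g := (contDiff_timeFactor L M s).continuous
    have hvc : ContinuousOn (fun q : En n × ℝ =>
        g q.2 * (r ^ 2 - ‖q.1 - p‖ ^ 2) ^ 2 / u q.1 q.2) K :=
      ContinuousOn.div (by fun_prop) (hcont.mono hKQ) fun q hq => (hKpos q hq).ne'
    have hptK : (p, t) ∈ K := ⟨hp, h0t, hts.le⟩
    obtain ⟨⟨y, σ⟩, hyK, hmax⟩ := hKc.exists_isMaxOn ⟨_, hptK⟩ hvc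
    have hle : ∀ q ∈ K, g q.2 * (r ^ 2 - ‖q.1 - p‖ ^ 2) ^ 2 / u q.1 q.2
        ≤ g σ * (r ^ 2 - ‖y - p‖ ^ 2) ^ 2 / u y σ := fun q hq => hmax hq
    have hgt : 0 < g t := timeFactor_pos hM hts
    have hpt := hle _ hptK
    simp only [sub_self, norm_zero, ne_eq, OfNat.ofNat_ne_zero, not_false_eq_true, zero_pow,
      sub_zero] at hpt
    set θ := g σ * (r ^ 2 - ‖y - p‖ ^ 2) ^ 2 / u y σ with hθ
    have hupt : 0 < u p t := hKpos _ hptK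
    have huy : 0 < u y σ := hKpos _ hyK
    have hθpos : 0 < θ := lt_of_lt_of_le (by positivity) hpt
    have hvpos : 0 < g σ * (r ^ 2 - ‖y - p‖ ^ 2) ^ 2 := by
      have := mul_pos hθpos huy
      rwa [hθ, div_mul_cancel₀ _ huy.ne'] at this
    have hφ : 0 < (r ^ 2 - ‖y - p‖ ^ 2) ^ 2 :=
      lt_of_le_of_ne (sq_nonneg _) fun h => by rw [← h, mul_zero] at hvpos; exact hvpos.false
    have hgσ : 0 < g σ := pos_of_mul_pos_left hvpos hφ.le
    have hσs : σ < s := lt_of_le_of_ne hyK.2.2 fun h => by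
      rw [h, hg] at hgσ
      simp [timeFactor] at hgσ
    have hyr : ‖y - p‖ ≤ r := by simpa [dist_eq_norm] using hyK.1
    have hyr' : ‖y - p‖ < r := lt_of_le_of_ne hyr fun h => by
      rw [h] at hφ
      simp at hφ
    have hσt : σ = t₀ := by
      by_contra hne
      have hσ : t₀ < σ := lt_of_le_of_ne hyK.2.1 (Ne.symm hne)
      have hloc : ∀ᶠ q in nhds ((y, σ) : En n × ℝ), q ∈ K :=
        prod_mem_nhds
          (mem_of_superset (isOpen_ball.mem_nhds (by simpa [dist_eq_norm] using hyr'))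
            ball_subset_closedBall) (Icc_mem_nhds hσ hσs)
      have heq : u y σ = θ⁻¹ * g σ * (r ^ 2 - ‖y - p‖ ^ 2) ^ 2 := by
        rw [mul_assoc, hθ, inv_div, div_mul_cancel₀ _ hvpos.ne']
      refine not_touch hk hB hsuper (g := g) (hL (y - p) hyr') (inv_pos.2 hθpos)
        (contDiff_timeFactor L M s) hgσ (hasDerivAt_timeFactor L M s σ) ?_ hφ (hKQ hyK) ?_ heq
      · have : 0 < Real.exp (-L * σ) * (M * Real.exp (M * (σ - s))) := by positivity
        linarith
      · refine Filter.Eventually.filter_mono nhdsWithin_le_nhds ?_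
        filter_upwards [hloc] with q hq
        have hq1 := hle q hq
        rw [div_le_iff₀ (hKpos q hq)] at hq1
        have : θ⁻¹ * (g q.2 * (r ^ 2 - ‖q.1 - p‖ ^ 2) ^ 2) ≤ u q.1 q.2 := by
          rw [inv_mul_le_iff₀ hθpos]; exact hq1
        simp only [heq, sub_self]
        linarith
    have hg1 : g σ ≤ 1 := by
      have h1 : Real.exp (-L * σ) ≤ 1 := Real.exp_le_one_iff.2 (by
        rw [hσt]; nlinarith [mul_nonneg hL0 ht₀.le])
      have h2 : 0 ≤ Real.exp (M * (σ - s)) := (Real.exp_pos _).le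
      have h3 : Real.exp (M * (σ - s)) ≤ 1 := Real.exp_le_one_iff.2 (by nlinarith)
      exact mul_le_one₀ h1 (by linarith) (by linarith)
    have hφr : (r ^ 2 - ‖y - p‖ ^ 2) ^ 2 ≤ (r ^ 2) ^ 2 :=
      pow_le_pow_left₀ (by nlinarith [norm_nonneg (y - p)])
        (by nlinarith [norm_nonneg (y - p)]) 2
    have hθm : θ ≤ (r ^ 2) ^ 2 / m := by
      refine div_le_div₀ (by positivity) ?_ hm (by rw [hσt]; exact hmu y hyK.1)
      nlinarith
    have h5 := hpt.trans hθm
    rw [div_le_div_iff₀ hupt hm] at h5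
    have hr4 : 0 < (r ^ 2) ^ 2 := by positivity
    have h6 : (r ^ 2) ^ 2 * (m * g t) ≤ (r ^ 2) ^ 2 * u p t := by
      ring_nf at h5 ⊢
      linarith
    exact le_of_mul_le_mul_left h6 hr4
  set c := m * (Real.exp (-L * τ) * (1 - Real.exp (-1))) with hc
  have he1 : 0 < 1 - Real.exp (-1) := sub_pos.2 (Real.exp_lt_one_iff.2 (by norm_num))
  have hcpos : 0 < c := by positivity
  have hlow : ∀ t ∈ Ico t₀ τ, c ≤ u p t := by
    intro t ht
    obtain ⟨s, hts, hsτ⟩ := exists_between ht.2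
    have hst : 0 < s - t := sub_pos.2 hts
    refine le_trans ?_ (key t s (1 / (s - t)) ht.1 hts hsτ (by positivity))
    have hexp : 1 / (s - t) * (t - s) = -1 := by field_simp; ring
    rw [hc, timeFactor, hexp]
    have : Real.exp (-L * τ) ≤ Real.exp (-L * t) := Real.exp_le_exp.2 (by nlinarith [ht.2.le])
    gcongr
  have hpc : ContinuousOn (fun t => u p t) (Icc t₀ τ) :=
    hcont.comp (f := fun t : ℝ => (p, t)) (by fun_prop)
      fun t ht => ⟨hrΩ hp, ht₀.trans_le ht.1, ht.2.trans_lt hτT⟩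
  have hlim : Tendsto (fun t => u p t) (nhdsWithin τ (Ico t₀ τ)) (nhds (u p τ)) :=
    (hpc τ ⟨htτ.le, le_rfl⟩).mono_left (nhdsWithin_mono _ Ico_subset_Icc_self)
  have : (nhdsWithin τ (Ico t₀ τ)).NeBot := by
    rw [nhdsWithin_Ico_eq_nhdsLT htτ]; infer_instance
  exact hcpos.trans_le (ge_of_tendsto hlim (eventually_mem_nhdsWithin.mono hlow))

/-- for k > 1 and m = 0, zeros of a continuous nonnegative supersolution
are not isolated: they are approached from earlier times. -/
theorem zeros_not_isolated_k_gt_one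
    {n : ℕ} (hn : 2 ≤ n)
    (H : En n → Sym n → ℝ) (k₁ k : ℝ) (hk : k = k₁ + 1) (hkk : 1 < k)
    (hA : CondA H) (hB : CondB H k₁) (hC : CondC H)
    (Ω : Set (En n)) (hΩo : IsOpen Ω) (hΩc : IsConnected Ω)
    (hΩb : Bornology.IsBounded Ω)
    (T : ℝ) (hT : 0 < T)
    (u : En n → ℝ → ℝ)
    (hcont : ContinuousOn (fun p : En n × ℝ => u p.1 p.2) (pcyl Ω T))
    (hunn : ∀ q ∈ pcyl Ω T, 0 ≤ u q.1 q.2)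
    (hsuper : ParSuper H k (pcyl Ω T) u)
    (hinf : sInf ((fun p : En n × ℝ => u p.1 p.2) '' pcyl Ω T) = 0)
    (p : En n) (τ : ℝ) (hpτ : (p, τ) ∈ pcyl Ω T) (hz : u p τ = 0) :
    ∃ f : ℕ → En n × ℝ,
      (∀ ℓ, f ℓ ∈ pcyl Ω T ∧ (f ℓ).2 < τ ∧ u (f ℓ).1 (f ℓ).2 = 0) ∧
      Filter.Tendsto f Filter.atTop (nhds (p, τ)) := by
  have hnear : ∀ ε > 0, ∃ q ∈ pcyl Ω T, q.2 < τ ∧ u q.1 q.2 = 0 ∧ dist q (p, τ) < ε := by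
    intro ε hε
    by_contra hno
    push Not at hno
    obtain ⟨r₀, hr₀, hball⟩ := Metric.isOpen_iff.1 hΩo p hpτ.1
    have hτ0 : 0 < τ := hpτ.2.1
    set r := min r₀ ε / 2 with hr
    have hmin : 0 < min r₀ ε := lt_min hr₀ hε
    have hrpos : 0 < r := by positivity
    have hrr₀ : r < r₀ := by have := min_le_left r₀ ε; linarith
    have hrε : r < ε := by have := min_le_right r₀ ε; linarith
    obtain ⟨t₀, ht₀, htτ⟩ := exists_between (max_lt hτ0 (sub_lt_self τ hε))
    have hsub : closedBall p r ⊆ Ω := (closedBall_subset_ball hrr₀).trans hball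
    have ht₀pos : 0 < t₀ := (le_max_left _ _).trans_lt ht₀
    have ht₀ε : τ - ε < t₀ := (le_max_right _ _).trans_lt ht₀
    refine (pos_of_pos_before hk hA hB hC hcont hsuper hrpos hsub ht₀pos htτ hpτ.2.2 ?_).ne' hz
    intro x hx t ht
    have hQ : (x, t) ∈ pcyl Ω T := ⟨hsub hx, ht₀pos.trans_le ht.1, ht.2.trans hpτ.2.2⟩
    refine lt_of_le_of_ne (hunn _ hQ) fun h => ?_
    refine (hno _ hQ ht.2 h.symm).not_gt ?_
    rw [Prod.dist_eq]
    refine max_lt ((mem_closedBall.1 hx).trans_lt hrε) ?_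
    rw [Real.dist_eq, abs_lt]
    constructor <;> linarith [ht.1, ht.2]
  choose f hfQ hfτ hfu hfd using fun ℓ : ℕ => hnear (1 / ((ℓ : ℝ) + 1)) (by positivity)
  refine ⟨f, fun ℓ => ⟨hfQ ℓ, hfτ ℓ, hfu ℓ⟩, tendsto_iff_dist_tendsto_zero.2 ?_⟩
  exact squeeze_zero (fun _ => dist_nonneg) (fun ℓ => (hfd ℓ).le)
    tendsto_one_div_add_atTop_nhds_zero_nat

end DNLP
end
end

section
/- Let n ≥ 2, let Ω ⊂ ℝ^n be a bounded domain, and let H satisfy Conditions A, B, C with k ≥ 1. Let h ∈ C(P_∞) satisfy 0 < inf_{P_∞} h ≤ sup_{P_∞} h < ∞. Let u be lower semicontinuous on Ω_∞ ∪ P_∞ with u > 0, a viscosity supersolution of Γ_k[u] = H(Du,D²u) − u^{k−1}u_t = 0 in Ω_∞, with u ≥ h on P_∞ and u = h on ∂Ω × [T,∞) for some T > 0. Set ν_inf = lim_{t→∞} ( inf_{∂Ω × [t,∞)} h ). Then lim_{t→∞} ( inf_{cl(Ω) × [t,∞)} u ) = ν_inf. -/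
open Set Filter Metric

noncomputable section

namespace DNLP

variable {n : ℕ}

lemma hasFDerivAt_quadratic (a c : ℝ) (z y : En n) :
    HasFDerivAt (fun x : En n => a * (‖x - z‖ ^ 2 / 2) + c) (a • innerSL ℝ (y - z)) y := by
  have h : HasFDerivAt (fun x : En n => a * (‖x - z‖ ^ 2 * (1 / 2)) + c) _ y :=
    ((((hasFDerivAt_id y).sub_const z).norm_sq.mul_const (1 / 2)).const_mul a).add_const c
  simp only [div_eq_mul_one_div (_ ^ 2) (2 : ℝ)]
  refine h.congr_fderiv ?_
  ext v
  simp

lemma gradient_quadratic (a c : ℝ) (z y : En n) :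
    gradient (fun x : En n => a * (‖x - z‖ ^ 2 / 2) + c) y = a • (y - z) := by
  apply HasGradientAt.gradient
  rw [hasGradientAt_iff_hasFDerivAt]
  refine (hasFDerivAt_quadratic a c z y).congr_fderiv ?_
  ext v
  simp

lemma hessian_quadratic (a c : ℝ) (z y : En n) :
    (Matrix.of fun i j =>
      fderiv ℝ (fun x => fderiv ℝ (fun x' : En n => a * (‖x' - z‖ ^ 2 / 2) + c) x
        (EuclideanSpace.single j (1 : ℝ))) y (EuclideanSpace.single i (1 : ℝ))) =
      (a • 1 : Sym n) := by
  ext i j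
  simp only [(hasFDerivAt_quadratic a c z _).fderiv, Matrix.of_apply, smul_apply,
    innerSL_apply_apply, smul_eq_mul]
  have h : HasFDerivAt (fun x : En n => a * inner ℝ (x - z) (EuclideanSpace.single j (1 : ℝ)))
      (a • (innerSL ℝ (EuclideanSpace.single j (1 : ℝ) : En n))) y := by
    have h1 := ((innerSL ℝ (EuclideanSpace.single j (1 : ℝ) : En n)).hasFDerivAt.comp y
      ((hasFDerivAt_id y).sub_const z)).const_mul a
    refine h1.congr_of_eventuallyEq (Eventually.of_forall fun x => ?_)
    simp only [Function.comp, innerSL_apply_apply, id]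
    rw [real_inner_comm]
  rw [h.fderiv]
  simp [Matrix.one_apply, EuclideanSpace.inner_single_left, eq_comm]

/-- Condition C at `Λ = 0`, extended to all nonzero gradients by homogeneity. -/
lemma CondB.pos_of_ne_zero {H : En n → Sym n → ℝ} {k₁ : ℝ} (hB : CondB H k₁) (hC : CondC H)
    {p : En n} (hp : p ≠ 0) {a : ℝ} (ha : 0 < a) : 0 < H p (a • 1) := by
  have hnorm : 0 < ‖p‖ := norm_pos_iff.2 hp
  have he : ‖‖p‖⁻¹ • p‖ = 1 := by
    rw [norm_smul, norm_inv, norm_norm, inv_mul_cancel₀ hnorm.ne']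
  have h1 := (hC.1 0 zero_lt_one _ he).1
  rw [zero_smul, sub_zero] at h1
  have h2 : p = ‖p‖ • (‖p‖⁻¹ • p) := by
    rw [smul_smul, mul_inv_cancel₀ hnorm.ne', one_smul]
  rw [hB.2.2 a ha, h2, hB.2.1]
  exact mul_pos ha (mul_pos (Real.rpow_pos_of_pos (abs_pos.2 hnorm.ne') _) h1)

/-- A quadratic paraboloid, convex in space and concave in time, is a strict subsolution, hence
lies below any positive supersolution that dominates it on the boundary. -/
lemma ParSuper.paraboloid_le {H : En n → Sym n → ℝ} {k : ℝ} (hk : 1 ≤ k) {Ω : Set (En n)}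
    (hΩo : IsOpen Ω) (hΩb : Bornology.IsBounded Ω) {u : En n → ℝ → ℝ}
    (hlsc : LowerSemicontinuousOn (fun q : En n × ℝ => u q.1 q.2) (closure Ω ×ˢ Ici 0))
    (hupos : ∀ x ∈ closure Ω, ∀ t, 0 ≤ t → 0 < u x t) (hsuper : ParSuper H k (pcylInf Ω) u)
    {t₀ A : ℝ} (ht₀ : 0 ≤ t₀) (hA : 0 < A) (hlat : ∀ x ∈ frontier Ω, ∀ t, t₀ ≤ t → A ≤ u x t)
    {a δ κ : ℝ} {z : En n}
    (hδ : ∀ x ∈ closure Ω, a * (‖x - z‖ ^ 2 / 2) ≤ δ)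
    (hH : ∀ x ∈ closure Ω, κ ≤ H (a • (x - z)) (a • 1))
    {t₁ : ℝ} (ht₁ : t₀ < t₁) (hlarge : 2 * A * A ^ (k - 1) < κ * (t₁ - t₀))
    {x : En n} (hx : x ∈ closure Ω) : a * (‖x - z‖ ^ 2 / 2) - δ + A ≤ u x t₁ := by
  by_contra! hlt
  have hd : 0 < t₁ - t₀ := sub_pos.2 ht₁
  obtain ⟨s, hs⟩ : ∃ s, s = A / (t₁ - t₀) ^ 2 := ⟨_, rfl⟩
  have hs0 : 0 < s := hs ▸ div_pos hA (pow_pos hd 2)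
  have hsA : s * (t₁ - t₀) ^ 2 = A := by rw [hs]; field_simp
  set ψ : En n → ℝ → ℝ := fun x t => a * (‖x - z‖ ^ 2 / 2) + (A - δ - s * (t - t₁) ^ 2) with hψ
  have htest : IsTestFn ψ := by
    constructor
    · intro t
      have : ContDiff ℝ 2 fun x : En n => ‖x - z‖ ^ 2 := (contDiff_id.sub contDiff_const).norm_sq ℝ
      exact (contDiff_const.mul (this.div_const 2)).add contDiff_const
    · intro x
      simp only [hψ]
      fun_prop
  have hψc : Continuous fun q : En n × ℝ => ψ q.1 q.2 := by
    simp only [hψ]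
    fun_prop
  set K : Set (En n × ℝ) := closure Ω ×ˢ Icc t₀ (2 * t₁ - t₀)
  have hKc : IsCompact K := hΩb.isCompact_closure.prod isCompact_Icc
  have hKsub : K ⊆ closure Ω ×ˢ Ici 0 :=
    prod_mono subset_rfl fun t ht => ht₀.trans ht.1
  have hxK : (x, t₁) ∈ K := ⟨hx, ht₁.le, by simp only; linarith⟩
  have hlscK : LowerSemicontinuousOn (fun q : En n × ℝ => u q.1 q.2 - ψ q.1 q.2) K := by
    simp only [sub_eq_add_neg]
    have hψn : Continuous fun q : En n × ℝ => -ψ q.1 q.2 := hψc.neg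
    exact (hlsc.mono hKsub).add (hψn.lowerSemicontinuous.lowerSemicontinuousOn K)
  obtain ⟨⟨y, t⟩, ⟨hy, htl, htr⟩, hmin⟩ := hlscK.exists_isMinOn ⟨_, hxK⟩ hKc
  simp only at hy htl htr
  have hneg : u y t < ψ y t := by
    have h1 : u y t - ψ y t ≤ u x t₁ - ψ x t₁ := hmin hxK
    have h2 : ψ x t₁ = a * (‖x - z‖ ^ 2 / 2) + (A - δ) := by simp [hψ]
    linarith
  have hψle : ψ y t ≤ A - s * (t - t₁) ^ 2 := by
    have := hδ y hy
    simp only [hψ]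
    linarith
  have huy : 0 < u y t := hupos y hy t (ht₀.trans htl)
  have huA : u y t ≤ A := by
    have : 0 ≤ s * (t - t₁) ^ 2 := by positivity
    linarith
  have hsq : (t - t₁) ^ 2 < (t₁ - t₀) ^ 2 := by
    by_contra! h
    have := mul_le_mul_of_nonneg_left h hs0.le
    linarith
  have habs := abs_lt_of_sq_lt_sq' hsq hd.le
  have hyΩ : y ∈ Ω := by
    by_contra hyn
    have := hlat y ⟨hy, by rwa [hΩo.interior_eq]⟩ t htl
    have : 0 < s * (t - t₁) ^ 2 ∨ s * (t - t₁) ^ 2 = 0 :=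
      (show 0 ≤ s * (t - t₁) ^ 2 by positivity).lt_or_eq.imp id Eq.symm
    rcases this with h | h <;> linarith
  have hnhds : K ∈ nhds (y, t) :=
    prod_mem_nhds (mem_of_superset (hΩo.mem_nhds hyΩ) subset_closure)
      (Icc_mem_nhds (by linarith [habs.1]) (by linarith [habs.2]))
  have hloc : IsLocalMinOn (fun p : En n × ℝ => u p.1 p.2 - ψ p.1 p.2) (pcylInf Ω) (y, t) :=
    (hmin.isLocalMin hnhds).on _
  have ht0 : 0 < t := by linarith [habs.1]
  have hvisc := hsuper ψ htest y t ⟨hyΩ, ht0⟩ hloc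
  have hgrad : sgrad ψ y t = a • (y - z) := gradient_quadratic a _ z y
  have hhess : shess ψ y t = a • 1 := hessian_quadratic a _ z y
  have htime : tpartial ψ y t = 2 * s * (t₁ - t) := by
    have h := ((((((hasDerivAt_id t).sub_const t₁).pow 2).const_mul s).const_sub (A - δ)).const_add
      (a * (‖y - z‖ ^ 2 / 2)))
    have h' : tpartial ψ y t = _ := h.deriv
    rw [h']
    simp
    ring
  rw [hgrad, hhess, htime] at hvisc
  have hκH := hH y hy
  have hpow : u y t ^ (k - 1) ≤ A ^ (k - 1) := Real.rpow_le_rpow huy.le huA (by linarith)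
  have hpow0 : 0 < u y t ^ (k - 1) := Real.rpow_pos_of_pos huy _
  have htime_le : 2 * s * (t₁ - t) ≤ 2 * s * (t₁ - t₀) :=
    mul_le_mul_of_nonneg_left (by linarith) (by positivity)
  have h1 : u y t ^ (k - 1) * (2 * s * (t₁ - t)) ≤ A ^ (k - 1) * (2 * s * (t₁ - t₀)) :=
    (mul_le_mul_of_nonneg_left htime_le hpow0.le).trans
      (mul_le_mul_of_nonneg_right hpow (by positivity))
  have h2 : A ^ (k - 1) * (2 * s * (t₁ - t₀)) < κ := by
    refine lt_of_mul_lt_mul_right ?_ hd.le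
    calc A ^ (k - 1) * (2 * s * (t₁ - t₀)) * (t₁ - t₀)
        = 2 * (s * (t₁ - t₀) ^ 2) * A ^ (k - 1) := by ring
      _ < κ * (t₁ - t₀) := by rwa [hsA]
  linarith

/-- A positive supersolution that is at least `A` on the lateral boundary from time `t₀` on is
eventually at least `A - δ` everywhere. -/
lemma ParSuper.eventually_le {H : En n → Sym n → ℝ} {k₁ k : ℝ} (hk : 1 ≤ k)
    (hA : CondA H) (hB : CondB H k₁) (hC : CondC H) [Nontrivial (En n)] {Ω : Set (En n)}
    (hΩo : IsOpen Ω) (hΩn : Ω.Nonempty) (hΩb : Bornology.IsBounded Ω) {u : En n → ℝ → ℝ}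
    (hlsc : LowerSemicontinuousOn (fun q : En n × ℝ => u q.1 q.2) (closure Ω ×ˢ Ici 0))
    (hupos : ∀ x ∈ closure Ω, ∀ t, 0 ≤ t → 0 < u x t) (hsuper : ParSuper H k (pcylInf Ω) u)
    {t₀ A : ℝ} (ht₀ : 0 ≤ t₀) (hA0 : 0 < A) (hlat : ∀ x ∈ frontier Ω, ∀ t, t₀ ≤ t → A ≤ u x t)
    {δ : ℝ} (hδ : 0 < δ) :
    ∃ t₂, ∀ t, t₂ ≤ t → ∀ x ∈ closure Ω, A - δ ≤ u x t := by
  have hcomp : IsCompact (closure Ω) := hΩb.isCompact_closure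
  have : NoncompactSpace (En n) := NormedSpace.noncompactSpace ℝ (En n)
  obtain ⟨z, hz⟩ := (ne_univ_iff_exists_notMem _).1 hcomp.ne_univ
  obtain ⟨B, hBd⟩ := hcomp.bddAbove_image
    (f := fun x : En n => ‖x - z‖ ^ 2 / 2) (by fun_prop)
  have hBd' : ∀ x ∈ closure Ω, ‖x - z‖ ^ 2 / 2 ≤ B := fun x hx => hBd (mem_image_of_mem _ hx)
  have hB0 : 0 ≤ B := by
    obtain ⟨x, hx⟩ := hΩn
    exact le_trans (by positivity) (hBd' x (subset_closure hx))
  obtain ⟨a, ha, haB⟩ : ∃ a : ℝ, 0 < a ∧ a * B ≤ δ := by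
    refine ⟨δ / (B + 1), by positivity, ?_⟩
    rw [div_mul_eq_mul_div, div_le_iff₀ (by positivity)]
    nlinarith
  have hHc : Continuous fun x : En n => H (a • (x - z)) (a • 1) :=
    hA.1.comp (Continuous.prodMk (by fun_prop) continuous_const)
  obtain ⟨x₀, hx₀, hmin⟩ := hcomp.exists_isMinOn hΩn.closure hHc.continuousOn
  have hκ : 0 < H (a • (x₀ - z)) (a • 1) := by
    refine hB.pos_of_ne_zero hC (smul_ne_zero ha.ne' (sub_ne_zero.2 ?_)) ha
    rintro rfl
    exact hz hx₀
  set κ := H (a • (x₀ - z)) (a • 1)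
  refine ⟨t₀ + 2 * A * A ^ (k - 1) / κ + 1, fun t ht x hx => ?_⟩
  have hq : 0 < 2 * A * A ^ (k - 1) / κ := by positivity
  have hbar := hsuper.paraboloid_le hk hΩo hΩb hlsc hupos ht₀ hA0 hlat
    (fun x hx => (mul_le_mul_of_nonneg_left (hBd' x hx) ha.le).trans haB)
    (fun x hx => hmin hx) (t₁ := t) (by linarith)
    (by rw [mul_comm κ, ← div_lt_iff₀ hκ]; linarith) hx
  have : 0 ≤ a * (‖x - z‖ ^ 2 / 2) := by positivity
  linarith

lemma pcylInf_union_pbdryInf (Ω : Set (En n)) (hΩ : IsOpen Ω) :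
    pcylInf Ω ∪ pbdryInf Ω = closure Ω ×ˢ Ici 0 := by
  ext ⟨x, t⟩
  simp only [pcylInf, pbdryInf, mem_union, mem_prod, mem_Ioi, mem_singleton_iff, mem_Ici,
    hΩ.frontier_eq, Set.mem_sdiff]
  constructor
  · rintro (⟨hx, ht⟩ | ⟨hx, ht⟩ | ⟨hx, ht⟩)
    · exact ⟨subset_closure hx, ht.le⟩
    · exact ⟨hx, ht.ge⟩
    · exact ⟨hx.1, ht⟩
  · rintro ⟨hx, ht⟩
    rcases ht.eq_or_lt with h | h
    · exact Or.inr (Or.inl ⟨hx, h.symm⟩)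
    · by_cases hxΩ : x ∈ Ω
      · exact Or.inl ⟨hxΩ, h⟩
      · exact Or.inr (Or.inr ⟨⟨hx, hxΩ⟩, ht⟩)

/-- large time behaviour of the infimum of a positive supersolution. -/
theorem large_time_inf_supersolution
    {n : ℕ} (hn : 2 ≤ n)
    (H : En n → Sym n → ℝ) (k₁ k : ℝ) (hk : k = k₁ + 1) (hk1 : 1 ≤ k)
    (hA : CondA H) (hB : CondB H k₁) (hC : CondC H)
    (Ω : Set (En n)) (hΩo : IsOpen Ω) (hΩc : IsConnected Ω)
    (hΩb : Bornology.IsBounded Ω)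
    (h : En n → ℝ → ℝ)
    (hhc : ContinuousOn (fun q : En n × ℝ => h q.1 q.2) (pbdryInf Ω))
    (hhbddBelow : BddBelow ((fun q : En n × ℝ => h q.1 q.2) '' pbdryInf Ω))
    (hhinfpos : 0 < sInf ((fun q : En n × ℝ => h q.1 q.2) '' pbdryInf Ω))
    (hhbddAbove : BddAbove ((fun q : En n × ℝ => h q.1 q.2) '' pbdryInf Ω))
    (u : En n → ℝ → ℝ)
    (hlsc : LowerSemicontinuousOn (fun q : En n × ℝ => u q.1 q.2)
      (pcylInf Ω ∪ pbdryInf Ω))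
    (hupos : ∀ q ∈ pcylInf Ω ∪ pbdryInf Ω, 0 < u q.1 q.2)
    (hsuper : ParSuper H k (pcylInf Ω) u)
    (hgeq : ∀ q ∈ pbdryInf Ω, h q.1 q.2 ≤ u q.1 q.2)
    (T : ℝ) (hT : 0 < T)
    (heq : ∀ x ∈ frontier Ω, ∀ t, T ≤ t → u x t = h x t)
    (νinf : ℝ)
    (hν : Filter.Tendsto
      (fun t : ℝ => sInf ((fun q : En n × ℝ => h q.1 q.2) '' (frontier Ω ×ˢ Ici t)))
      Filter.atTop (nhds νinf)) :
    Filter.Tendsto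
      (fun t : ℝ => sInf ((fun q : En n × ℝ => u q.1 q.2) '' (closure Ω ×ˢ Ici t)))
      Filter.atTop (nhds νinf) := by
  have : Nonempty (Fin n) := ⟨⟨0, by omega⟩⟩
  have : NoncompactSpace (En n) := NormedSpace.noncompactSpace ℝ (En n)
  rw [pcylInf_union_pbdryInf Ω hΩo] at hlsc hupos
  have hupos' : ∀ x ∈ closure Ω, ∀ t, 0 ≤ t → 0 < u x t := fun x hx t ht => hupos (x, t) ⟨hx, ht⟩
  have hfr : (frontier Ω).Nonempty := by
    refine nonempty_frontier_iff.2 ⟨hΩc.nonempty, ?_⟩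
    rintro rfl
    exact hΩb.isCompact_closure.ne_univ closure_univ
  have hlat : ∀ t : ℝ, 0 ≤ t → frontier Ω ×ˢ Ici t ⊆ pbdryInf Ω := fun t ht =>
    (prod_mono subset_rfl (Ici_subset_Ici.2 ht)).trans subset_union_right
  have hle : ∀ t, T ≤ t →
      sInf ((fun q : En n × ℝ => u q.1 q.2) '' (closure Ω ×ˢ Ici t)) ≤
        sInf ((fun q : En n × ℝ => h q.1 q.2) '' (frontier Ω ×ˢ Ici t)) := by
    intro t ht
    refine csInf_le_csInf ⟨0, ?_⟩ ((hfr.prod nonempty_Ici).image _) ?_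
    · rintro _ ⟨⟨x, r⟩, ⟨hx, hr⟩, rfl⟩
      exact (hupos' x hx r ((hT.le.trans ht).trans hr)).le
    · rintro _ ⟨⟨x, r⟩, ⟨hx, hr⟩, rfl⟩
      exact ⟨(x, r), ⟨frontier_subset_closure hx, hr⟩, heq x hx r (ht.trans hr)⟩
  rw [tendsto_order] at hν ⊢
  refine ⟨fun a ha => ?_, fun a ha => ?_⟩
  · obtain ⟨b, hab, hb⟩ := exists_between ha
    obtain ⟨t₀, hbA, htT⟩ := ((hν.1 b hb).and (eventually_ge_atTop T)).exists
    have ht₀ : 0 ≤ t₀ := hT.le.trans htT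
    set A := sInf ((fun q : En n × ℝ => h q.1 q.2) '' (frontier Ω ×ˢ Ici t₀))
    have hA0 : 0 < A := hhinfpos.trans_le <|
      csInf_le_csInf hhbddBelow ((hfr.prod nonempty_Ici).image _) (image_mono (hlat t₀ ht₀))
    have hAu : ∀ x ∈ frontier Ω, ∀ t, t₀ ≤ t → A ≤ u x t := fun x hx t ht =>
      (csInf_le (hhbddBelow.mono (image_mono (hlat t₀ ht₀))) ⟨(x, t), ⟨hx, ht⟩, rfl⟩).trans
        (hgeq (x, t) (hlat t₀ ht₀ ⟨hx, ht⟩))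
    obtain ⟨t₂, ht₂⟩ := hsuper.eventually_le hk1 hA hB hC hΩo hΩc.nonempty hΩb hlsc hupos' ht₀ hA0
      hAu (sub_pos.2 hab)
    filter_upwards [eventually_ge_atTop t₂] with t ht
    have : A - (b - a) ≤ sInf ((fun q : En n × ℝ => u q.1 q.2) '' (closure Ω ×ˢ Ici t)) := by
      refine le_csInf ((hΩc.nonempty.closure.prod nonempty_Ici).image _) ?_
      rintro _ ⟨⟨x, r⟩, ⟨hx, hr⟩, rfl⟩
      exact ht₂ r (ht.trans hr) x hx
    linarith
  · filter_upwards [hν.2 a ha, eventually_ge_atTop T] with t h1 h2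
    exact (hle t h2).trans_lt h1

end DNLP
end
end

section
/- Let n ≥ 2, let Ω ⊂ ℝ^n be a bounded domain, 0 < T < ∞, and let H satisfy Condition A, with k ≥ 1. Let u be upper semicontinuous on Ω_T ∪ P_T with u ≥ 0 and a viscosity subsolution of Γ_k[u] = H(Du,D²u) − u^{k−1}u_t = 0 in Ω_T, and let ε ≥ 0. Then u_ε = max{u, ε} is a viscosity subsolution of Γ_k[u_ε] = 0 in Ω_T. Similarly, if v is a viscosity supersolution (Γ_k[v] ≤ 0) in Ω_T, then v_ε = min{v, ε} is a viscosity supersolution. -/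
open Set Filter Metric

noncomputable section

namespace DNLP

variable {n : ℕ}

/-- Second derivative test, necessary condition on the line. -/
lemma deriv_deriv_nonneg_of_isLocalMin {g : ℝ → ℝ} {x : ℝ} (hg : ContinuousAt g x)
    (h : IsLocalMin g x) : 0 ≤ deriv (deriv g) x := by
  by_contra! hneg
  have hmax : IsLocalMax g x := isLocalMax_of_deriv_deriv_neg hneg h.deriv_eq_zero hg
  have hconst : g =ᶠ[nhds x] fun _ => g x := by
    filter_upwards [h, hmax] with z h₁ h₂ using le_antisymm h₂ h₁
  have hzero : deriv (deriv g) x = 0 := by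
    rw [hconst.deriv.deriv_eq]
    simp
  exact hneg.ne hzero

/-- Second derivative test, necessary condition in a normed space. -/
lemma fderiv_fderiv_nonneg_of_isLocalMin {E : Type*} [NormedAddCommGroup E] [NormedSpace ℝ E]
    {f : E → ℝ} (hf : ContDiff ℝ 2 f) {y : E} (h : IsLocalMin f y) (v : E) :
    0 ≤ fderiv ℝ (fderiv ℝ f) y v v := by
  have hline (s : ℝ) : HasDerivAt (fun s : ℝ => y + s • v) v s := by
    simpa using ((hasDerivAt_id s).smul_const v).const_add y
  have hderiv : deriv (fun s : ℝ => f (y + s • v)) = fun s => fderiv ℝ f (y + s • v) v := by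
    ext s
    exact ((hf.differentiable (by norm_num) _).hasFDerivAt.comp_hasDerivAt s (hline s)).deriv
  have hf' : Differentiable ℝ (fderiv ℝ f) :=
    (hf.fderiv_right (m := 1) (by norm_num)).differentiable (by norm_num)
  have hderiv₂ : deriv (fun s : ℝ => fderiv ℝ f (y + s • v) v) 0 =
      fderiv ℝ (fderiv ℝ f) y v v := by
    have hline' : HasDerivAt (fun s : ℝ => fderiv ℝ f (y + s • v))
        (fderiv ℝ (fderiv ℝ f) y v) 0 :=
      (hf' y).hasFDerivAt.comp_hasDerivAt_of_eq 0 (hline 0) (by simp)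
    simpa using (hline'.clm_apply (hasDerivAt_const (0 : ℝ) v)).deriv
  have hcont : ContinuousAt (fun s : ℝ => y + s • v) 0 := (hline 0).continuousAt
  have hmin : IsLocalMin (fun s : ℝ => f (y + s • v)) 0 := by
    have h' : IsLocalMin f (y + (0 : ℝ) • v) := by simpa using h
    exact IsMinFilter.comp_tendsto h' hcont
  rw [← hderiv₂, ← hderiv]
  exact deriv_deriv_nonneg_of_isLocalMin (hf.continuous.continuousAt.comp hcont) hmin

lemma ehess_apply {f : En n → ℝ} (hf : ContDiff ℝ 2 f) (y : En n) (i j : Fin n) :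
    ehess f y i j = fderiv ℝ (fderiv ℝ f) y (EuclideanSpace.single i 1)
      (EuclideanSpace.single j 1) := by
  have hf' : Differentiable ℝ (fderiv ℝ f) :=
    (hf.fderiv_right (m := 1) (by norm_num)).differentiable (by norm_num)
  simp [ehess, fderiv_clm_apply (hf' y) (differentiableAt_const _)]

lemma ehess_neg (f : En n → ℝ) (y : En n) : ehess (fun x => -f x) y = -ehess f y := by
  ext i j
  simp [ehess, fderiv_fun_neg]

lemma ehess_posSemidef_of_isLocalMin {f : En n → ℝ} (hf : ContDiff ℝ 2 f) {y : En n}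
    (h : IsLocalMin f y) : (ehess f y).PosSemidef := by
  refine .of_dotProduct_mulVec_nonneg ?_ fun x => ?_
  · ext i j
    simpa [ehess_apply hf] using
      (hf.contDiffAt.isSymmSndFDerivAt (by simp)).eq (EuclideanSpace.single j 1)
        (EuclideanSpace.single i 1)
  · have hx : WithLp.toLp 2 x = ∑ i, x i • (EuclideanSpace.single i 1 : En n) := by
      simpa using ((EuclideanSpace.basisFun (Fin n) ℝ).sum_repr (WithLp.toLp 2 x)).symm
    have hnonneg := fderiv_fderiv_nonneg_of_isLocalMin hf h (WithLp.toLp 2 x)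
    rw [hx] at hnonneg
    have hsum : star x ⬝ᵥ (ehess f y).mulVec x = fderiv ℝ (fderiv ℝ f) y
        (∑ i, x i • EuclideanSpace.single i 1) (∑ i, x i • EuclideanSpace.single i 1) := by
      simp only [dotProduct, Matrix.mulVec, ehess_apply hf, Finset.mul_sum, map_sum, map_smul,
        sum_apply, smul_apply, smul_eq_mul,
        Pi.star_apply, star_trivial]
      rw [Finset.sum_comm]
      exact Finset.sum_congr rfl fun i _ => Finset.sum_congr rfl fun j _ => by ring
    rwa [hsum]

lemma ehess_neg_posSemidef_of_isLocalMax {f : En n → ℝ} (hf : ContDiff ℝ 2 f) {y : En n}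
    (h : IsLocalMax f y) : (-ehess f y).PosSemidef := by
  rw [← ehess_neg]
  exact ehess_posSemidef_of_isLocalMin hf.neg h.neg

lemma isOpen_pcyl {Ω : Set (En n)} (hΩ : IsOpen Ω) (T : ℝ) : IsOpen (pcyl Ω T) :=
  hΩ.prod isOpen_Ioo

/-- At an interior local minimum of a test function the operator is nonnegative, whatever the
coefficient of the time derivative. -/
lemma CondA.nonneg_of_isLocalMin {H : En n → Sym n → ℝ} (hA : CondA H) {ψ : En n → ℝ → ℝ}
    (hψ : IsTestFn ψ) {y : En n} {t : ℝ} (h : IsLocalMin (fun p : En n × ℝ => ψ p.1 p.2) (y, t))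
    (c : ℝ) : 0 ≤ H (sgrad ψ y t) (shess ψ y t) - c * tpartial ψ y t := by
  have hx : IsLocalMin (fun x => ψ x t) y :=
    h.comp_continuous (g := fun x => (x, t)) (by fun_prop)
  have ht : IsLocalMin (fun s => ψ y s) t :=
    h.comp_continuous (g := fun s => (y, s)) (by fun_prop)
  have hH := hA.2.2 (sgrad ψ y t) 0 (shess ψ y t)
    (by simpa [LoewnerLE, shess, ehess] using ehess_posSemidef_of_isLocalMin (hψ.1 t) hx)
  rw [hA.2.1] at hH
  simpa [tpartial, ht.deriv_eq_zero] using hH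

/-- At an interior local maximum of a test function the operator is nonpositive, whatever the
coefficient of the time derivative. -/
lemma CondA.nonpos_of_isLocalMax {H : En n → Sym n → ℝ} (hA : CondA H) {ψ : En n → ℝ → ℝ}
    (hψ : IsTestFn ψ) {y : En n} {t : ℝ} (h : IsLocalMax (fun p : En n × ℝ => ψ p.1 p.2) (y, t))
    (c : ℝ) : H (sgrad ψ y t) (shess ψ y t) - c * tpartial ψ y t ≤ 0 := by
  have hx : IsLocalMax (fun x => ψ x t) y :=
    h.comp_continuous (g := fun x => (x, t)) (by fun_prop)
  have ht : IsLocalMax (fun s => ψ y s) t :=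
    h.comp_continuous (g := fun s => (y, s)) (by fun_prop)
  have hH := hA.2.2 (sgrad ψ y t) (shess ψ y t) 0
    (by simpa [LoewnerLE, shess, ehess] using ehess_neg_posSemidef_of_isLocalMax (hψ.1 t) hx)
  rw [hA.2.1] at hH
  simpa [tpartial, ht.deriv_eq_zero] using hH

/-- max{u,ε} is a subsolution when u is; min{v,ε} is a supersolution
when v is. -/
theorem truncation_sub_supersolution
    {n : ℕ} (hn : 2 ≤ n)
    (H : En n → Sym n → ℝ) (hA : CondA H) (k : ℝ) (hk : 1 ≤ k)
    (Ω : Set (En n)) (hΩo : IsOpen Ω) (hΩc : IsConnected Ω)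
    (hΩb : Bornology.IsBounded Ω)
    (T : ℝ) (hT : 0 < T)
    (ε : ℝ) (hε : 0 ≤ ε) :
    (∀ u : En n → ℝ → ℝ,
      UpperSemicontinuousOn (fun q : En n × ℝ => u q.1 q.2) (pcyl Ω T ∪ pbdry Ω T) →
      (∀ q ∈ pcyl Ω T ∪ pbdry Ω T, 0 ≤ u q.1 q.2) →
      ParSub H k (pcyl Ω T) u →
      ParSub H k (pcyl Ω T) (fun x t => max (u x t) ε)) ∧
    (∀ v : En n → ℝ → ℝ,
      LowerSemicontinuousOn (fun q : En n × ℝ => v q.1 q.2) (pcyl Ω T ∪ pbdry Ω T) →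
      ParSuper H k (pcyl Ω T) v →
      ParSuper H k (pcyl Ω T) (fun x t => min (v x t) ε)) := by
  constructor
  · intro u _ _ hu ψ hψ y t hyt hmax
    rcases le_or_gt ε (u y t) with hle | hlt
    · have heq : max (u y t) ε = u y t := max_eq_left hle
      have hmax' : IsLocalMaxOn (fun p : En n × ℝ => u p.1 p.2 - ψ p.1 p.2) (pcyl Ω T) (y, t) := by
        filter_upwards [hmax] with p hp
        simp only [heq] at hp
        linarith [le_max_left (u p.1 p.2) ε]
      simpa only [heq] using hu ψ hψ y t hyt hmax'
    · refine hA.nonneg_of_isLocalMin hψ ?_ _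
      filter_upwards [hmax.isLocalMax ((isOpen_pcyl hΩo T).mem_nhds hyt)] with p hp
      simp only [max_eq_right hlt.le] at hp
      linarith [le_max_right (u p.1 p.2) ε]
  · intro v _ hv ψ hψ y t hyt hmin
    rcases le_or_gt (v y t) ε with hle | hlt
    · have heq : min (v y t) ε = v y t := min_eq_left hle
      have hmin' : IsLocalMinOn (fun p : En n × ℝ => v p.1 p.2 - ψ p.1 p.2) (pcyl Ω T) (y, t) := by
        filter_upwards [hmin] with p hp
        simp only [heq] at hp
        linarith [min_le_left (v p.1 p.2) ε]
      simpa only [heq] using hv ψ hψ y t hyt hmin'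
    · refine hA.nonpos_of_isLocalMax hψ ?_ _
      filter_upwards [hmin.isLocalMin ((isOpen_pcyl hΩo T).mem_nhds hyt)] with p hp
      simp only [min_eq_right hlt.le] at hp
      linarith [min_le_right (v p.1 p.2) ε]

end DNLP
end
end
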